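/- arXiv:1912.03532 — 3 statements merged into one kernel-verified Lean document; each statement's English description precedes it below -/
import Mathlib

section
/- Let Ω be an open set of finite Lebesgue measure in ℝⁿ, n ≥ 2, let m ∈ ℕ with m < n, and let d ∈ (0, n]. Let ‖·‖_X and ‖·‖_Y be rearrangement-invariant function norms on (0,1). Let μ be a finite Borel measure on Ω with sup_{x ∈ ℝⁿ, r > 0} μ(B_r(x) ∩ Ω)/r^d < ∞, and suppose there exist x₀ ∈ Ω and R > 0 such that the closed ball of radius R centered at x₀ is contained in Ω and inf_{r ∈ (0,R]} μ(B_r(x₀) ∩ Ω)/r^d > 0. Suppose that there is a constant C₂ such that ‖ t ↦ u*_μ(μ(Ω)·t) ‖_Y ≤ C₂ ‖ t ↦ |v_{(m)}|*(|Ω|·t) ‖_X for every nonnegative function u : ℝⁿ → [0,∞) which is supported in the closed ball of radius R centered at x₀, is continuous on ℝⁿ∖{x₀}, and is m-times weakly differentiable with weak derivatives (v_α)_{|α| ≤ m}, where |v_{(m)}| denotes the Euclidean norm of the vector (v_α)_{|α| = m}. Then there exists a constant C₁ such that ‖ t ↦ ∫_{t^{n/d}}^1 f(s) s^{−1+m/n}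 ds ‖_Y ≤ C₁ ‖f‖_X for every nonnegative non-increasing measurable f on (0,1). -/
open MeasureTheory Set
open scoped ENNReal NNReal

/-- Lebesgue measure on the interval `(0,1)`. -/
noncomputable def vol01 : MeasureTheory.Measure ℝ :=
  MeasureTheory.volume.restrict (Set.Ioo 0 1)

/-- The non-increasing rearrangement on `(0,1)` of an extended-nonnegative function. -/
noncomputable def decRearr (f : ℝ → ℝ≥0∞) (s : ℝ) : ℝ≥0∞ :=
  sInf {ρ : ℝ≥0∞ | vol01 {t | ρ < f t} ≤ ENNReal.ofReal s}

/-- The non-increasing rearrangement of a real-valued function with respect to a measure. -/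
noncomputable def rearr {α : Type*} [MeasurableSpace α] (ν : MeasureTheory.Measure α)
    (u : α → ℝ) (s : ℝ) : ℝ≥0∞ :=
  sInf {ρ : ℝ≥0∞ | ν {x | ρ < ENNReal.ofReal |u x|} ≤ ENNReal.ofReal s}

/-- A rearrangement-invariant function norm on `(0,1)`: properties (P1)–(P6). -/
structure IsRINorm (N : (ℝ → ℝ≥0∞) → ℝ≥0∞) : Prop where
  eq_zero_iff : ∀ f : ℝ → ℝ≥0∞, N f = 0 ↔ (∀ᵐ t ∂vol01, f t = 0)
  smul : ∀ (c : ℝ≥0) (f : ℝ → ℝ≥0∞), N (fun t => (c : ℝ≥0∞) * f t) = (c : ℝ≥0∞) * N f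
  add_le : ∀ f g : ℝ → ℝ≥0∞, N (fun t => f t + g t) ≤ N f + N g
  mono : ∀ f g : ℝ → ℝ≥0∞, (∀ᵐ t ∂vol01, f t ≤ g t) → N f ≤ N g
  iSup_eq : ∀ (f : ℕ → ℝ → ℝ≥0∞) (g : ℝ → ℝ≥0∞),
    (∀ k, ∀ᵐ t ∂vol01, f k t ≤ f (k + 1) t) →
    (∀ᵐ t ∂vol01, (⨆ k, f k t) = g t) → N g = ⨆ k, N (f k)
  indicator_lt_top : ∀ E : Set ℝ, MeasurableSet E → E ⊆ Set.Ioo 0 1 → N (E.indicator 1) < ⊤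
  exists_integral_le : ∀ E : Set ℝ, MeasurableSet E → E ⊆ Set.Ioo 0 1 →
    ∃ C : ℝ≥0, ∀ f : ℝ → ℝ≥0∞, (∫⁻ t in E, f t) ≤ (C : ℝ≥0∞) * N f
  rearr_invariant : ∀ f g : ℝ → ℝ≥0∞, decRearr f = decRearr g → N f = N g

/-- The Hardy-type operator `S₁f(t) = ∫_{t^{n/d}}^1 f(s) s^{-1+m/n} ds`. -/
noncomputable def S1 (n m : ℕ) (d : ℝ) (f : ℝ → ℝ≥0∞) (t : ℝ) : ℝ≥0∞ :=
  ∫⁻ s in Set.Ioo (t ^ ((n : ℝ) / d)) 1, ENNReal.ofReal (s ^ ((m : ℝ) / n - 1)) * f s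

/-- The Hardy-type operator
`S₂f(t) = t^{-m/(n-d)} ∫_0^{t^{n/d}} f(s) s^{-1+m/(n-d)} ds`. -/
noncomputable def S2 (n m : ℕ) (d : ℝ) (f : ℝ → ℝ≥0∞) (t : ℝ) : ℝ≥0∞ :=
  ENNReal.ofReal (t ^ (-((m : ℝ) / ((n : ℝ) - d)))) *
    ∫⁻ s in Set.Ioo (0 : ℝ) (t ^ ((n : ℝ) / d)),
      ENNReal.ofReal (s ^ ((m : ℝ) / ((n : ℝ) - d) - 1)) * f s

/-- Functions with the same distribution have the same norm. -/
theorem IsRINorm.eq_of_distribution {N : (ℝ → ℝ≥0∞) → ℝ≥0∞} (hN : IsRINorm N)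
    {f g : ℝ → ℝ≥0∞} (h : ∀ ρ, vol01 {t | ρ < f t} = vol01 {t | ρ < g t}) : N f = N g :=
  hN.rearr_invariant f g (by funext s; simp only [decRearr, h])

/-- The dilation by a factor `2` has norm at most `2`. -/
theorem IsRINorm.dilate_two_le {N : (ℝ → ℝ≥0∞) → ℝ≥0∞} (hN : IsRINorm N) (G : ℝ → ℝ≥0∞) :
    N (fun t => G (t / 2)) ≤ 2 * N G := by
  set h₀ : ℝ → ℝ≥0∞ := (Ioo (0 : ℝ) (1 / 2)).indicator G with hh₀
  set h₁ : ℝ → ℝ≥0∞ := (Ioo (1 / 2 : ℝ) 1).indicator (fun t => G (t + -(1 / 2))) with hh₁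
  let A : ℝ≥0∞ → Set ℝ := fun ρ => {t | t ∈ Ioo (0 : ℝ) (1 / 2) ∧ ρ < G t}
  let A' : ℝ≥0∞ → Set ℝ := fun ρ => (fun t => t + -(1 / 2 : ℝ)) ⁻¹' A ρ
  have hA' : ∀ ρ, volume (A' ρ) = volume (A ρ) := fun ρ => measure_preimage_add_right _ _ _
  have e₀ : ∀ ρ, vol01 {t | ρ < h₀ t} = volume (A ρ) := by
    intro ρ
    rw [vol01, Measure.restrict_apply' measurableSet_Ioo]
    congr 1
    ext t
    by_cases ht : t ∈ Ioo (0 : ℝ) (1 / 2)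
    · have : t ∈ Ioo (0 : ℝ) 1 := ⟨ht.1, by linarith [ht.2]⟩
      simp only [mem_inter_iff, mem_ofPred_eq, hh₀, indicator_of_mem ht, this, A, ht]
      tauto
    · simp only [mem_inter_iff, mem_ofPred_eq, hh₀, indicator_of_notMem ht, A, ht]
      simp
  have key : ∀ t, (t + -(1 / 2 : ℝ) ∈ Ioo (0 : ℝ) (1 / 2) ↔ t ∈ Ioo (1 / 2 : ℝ) 1) := by
    intro t
    constructor
    · rintro ⟨h1, h2⟩; constructor <;> linarith
    · rintro ⟨h1, h2⟩; constructor <;> linarith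
  have e₁ : ∀ ρ, vol01 {t | ρ < h₁ t} = volume (A ρ) := by
    intro ρ
    rw [vol01, Measure.restrict_apply' measurableSet_Ioo, ← hA' ρ]
    congr 1
    ext t
    by_cases ht : t ∈ Ioo (1 / 2 : ℝ) 1
    · have h1 : t ∈ Ioo (0 : ℝ) 1 := ⟨by linarith [ht.1], ht.2⟩
      have h2 := (key t).2 ht
      simp only [mem_inter_iff, mem_ofPred_eq, hh₁, indicator_of_mem ht, h1, A, A', h2,
        mem_preimage]
      tauto
    · have h2 := mt (key t).1 ht
      simp only [mem_inter_iff, mem_ofPred_eq, hh₁, indicator_of_notMem ht, A, A', h2,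
        mem_preimage]
      simp
  have e₂ : ∀ ρ, vol01 {t | ρ < h₀ t + h₁ t} = 2 * volume (A ρ) := by
    intro ρ
    have hsum : 2 * volume (A ρ) = volume (A ρ) + volume (A' ρ) := by rw [hA', two_mul]
    rw [hsum, vol01, Measure.restrict_apply' measurableSet_Ioo,
      ← measure_inter_add_sdiff _ (measurableSet_Ioo : MeasurableSet (Ioo (0 : ℝ) (1 / 2)))]
    congr 2
    · ext t
      by_cases ht : t ∈ Ioo (0 : ℝ) (1 / 2)
      · have h1 : t ∈ Ioo (0 : ℝ) 1 := ⟨ht.1, by linarith [ht.2]⟩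
        have h2 : t ∉ Ioo (1 / 2 : ℝ) 1 := fun h => by linarith [ht.2, h.1]
        simp only [mem_inter_iff, mem_ofPred_eq, hh₀, hh₁, indicator_of_mem ht,
          indicator_of_notMem h2, h1, A, ht, add_zero]
        tauto
      · simp only [mem_inter_iff, A, mem_ofPred_eq, ht]
        simp
    · ext t
      by_cases ht : t ∈ Ioo (1 / 2 : ℝ) 1
      · have h1 : t ∈ Ioo (0 : ℝ) 1 := ⟨by linarith [ht.1], ht.2⟩
        have h3 : t ∉ Ioo (0 : ℝ) (1 / 2) := fun h => by linarith [ht.1, h.2]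
        have h2 := (key t).2 ht
        simp only [mem_inter_iff, mem_sdiff, mem_ofPred_eq, hh₀, hh₁, indicator_of_mem ht,
          indicator_of_notMem h3, h1, A, A', h2, h3, mem_preimage, zero_add]
        tauto
      · have h2 := mt (key t).1 ht
        simp only [mem_inter_iff, mem_sdiff, mem_ofPred_eq, A, A', h2, mem_preimage,
          false_and, iff_false]
        rintro ⟨⟨h3, -⟩, h4⟩
        change ρ < h₀ t + h₁ t at h3
        rw [hh₀, hh₁, indicator_of_notMem ht, indicator_of_notMem h4] at h3
        simp at h3
  have e₃ : ∀ ρ, vol01 {t | ρ < G (t / 2)} = 2 * volume (A ρ) := by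
    intro ρ
    rw [vol01, Measure.restrict_apply' measurableSet_Ioo]
    have h := Real.volume_preimage_mul_left (a := 1 / 2) (by norm_num) (A ρ)
    have h2 : ENNReal.ofReal |(1 / 2 : ℝ)⁻¹| = 2 := by norm_num
    rw [h2] at h
    rw [← h]
    congr 1
    ext t
    have h3 : (1 / 2 : ℝ) * t = t / 2 := by ring
    simp only [mem_inter_iff, mem_ofPred_eq, mem_preimage, A, h3, mem_Ioo]
    constructor
    · rintro ⟨h1, h2, h3⟩
      exact ⟨⟨by linarith, by linarith⟩, h1⟩
    · rintro ⟨⟨h1, h2⟩, h3⟩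
      exact ⟨h3, by linarith, by linarith⟩
  have hle : N h₀ ≤ N G := hN.mono _ _ (ae_of_all _ fun t => indicator_le_self _ _ t)
  calc N (fun t => G (t / 2)) = N (fun t => h₀ t + h₁ t) :=
        hN.eq_of_distribution fun ρ => by rw [e₂, e₃]
    _ ≤ N h₀ + N h₁ := hN.add_le _ _
    _ = N h₀ + N h₀ := by
        rw [hN.eq_of_distribution (f := h₁) (g := h₀) fun ρ => by rw [e₀, e₁]]
    _ ≤ 2 * N G := by rw [two_mul]; gcongr

/-- The dilation by a factor `2 ^ p` has norm at most `2 ^ p`. -/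
theorem IsRINorm.dilate_two_pow_le {N : (ℝ → ℝ≥0∞) → ℝ≥0∞} (hN : IsRINorm N) (p : ℕ)
    (G : ℝ → ℝ≥0∞) : N (fun t => G (t / 2 ^ p)) ≤ 2 ^ p * N G := by
  induction p with
  | zero => simp
  | succ p ih =>
    have h := hN.dilate_two_le (fun t => G (t / 2 ^ p))
    have e : (fun t : ℝ => G (t / 2 ^ (p + 1))) = fun t => G (t / 2 / 2 ^ p) := by
      funext t
      rw [div_div, pow_succ']
    rw [e, pow_succ', mul_assoc]
    exact h.trans (by gcongr)

/-- If the norm of a non-increasing function is finite, then so is the function. -/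
theorem IsRINorm.lt_top_of_antitoneOn {N : (ℝ → ℝ≥0∞) → ℝ≥0∞} (hN : IsRINorm N)
    {f : ℝ → ℝ≥0∞} (hf : AntitoneOn f (Ioo 0 1)) (h : N f ≠ ⊤) {t : ℝ}
    (ht : t ∈ Ioo (0 : ℝ) 1) : f t < ⊤ := by
  by_contra hcon
  rw [not_lt, top_le_iff] at hcon
  have hsub : Ioo 0 t ⊆ Ioo (0 : ℝ) 1 := Ioo_subset_Ioo_right ht.2.le
  obtain ⟨C, hC⟩ := hN.exists_integral_le (Ioo 0 t) measurableSet_Ioo hsub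
  have h1 : (∫⁻ s in Ioo 0 t, f s) = ⊤ := by
    rw [setLIntegral_congr_fun (g := fun _ => ⊤) measurableSet_Ioo]
    · simp [ht.1]
    · intro s hs
      exact top_le_iff.1 (hcon ▸ hf (hsub hs) ht hs.2.le)
  have h2 := hC f
  rw [h1, top_le_iff] at h2
  exact ENNReal.mul_ne_top ENNReal.coe_ne_top h h2

/-- Iterated partial derivatives of a function on Euclidean space. -/
noncomputable def partialDerivs {n : ℕ} (g : EuclideanSpace ℝ (Fin n) → ℝ) :
    List (Fin n) → EuclideanSpace ℝ (Fin n) → ℝ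
  | [] => g
  | i :: L => fun x => fderiv ℝ (partialDerivs g L) x (EuclideanSpace.single i (1 : ℝ))

theorem contDiff_partialDerivs {n : ℕ} {g : EuclideanSpace ℝ (Fin n) → ℝ}
    (hg : ContDiff ℝ (⊤ : ℕ∞) g) (L : List (Fin n)) :
    ContDiff ℝ (⊤ : ℕ∞) (partialDerivs g L) := by
  induction L with
  | nil => exact hg
  | cons i L ih => exact (ih.fderiv_right (by simp)).clm_apply contDiff_const

theorem partialDerivs_eventuallyEq_zero {n : ℕ} {g : EuclideanSpace ℝ (Fin n) → ℝ}
    {y : EuclideanSpace ℝ (Fin n)} {c : ℝ} (h : g =ᶠ[nhds y] fun _ => c) {L : List (Fin n)}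
    (hL : L ≠ []) : partialDerivs g L =ᶠ[nhds y] fun _ => 0 := by
  induction L with
  | nil => exact absurd rfl hL
  | cons i L ih =>
    have key : ∃ c' : ℝ, partialDerivs g L =ᶠ[nhds y] fun _ => c' := by
      by_cases h' : L = []
      · subst h'; exact ⟨c, h⟩
      · exact ⟨0, ih h'⟩
    obtain ⟨c', hc'⟩ := key
    filter_upwards [hc'.fderiv (𝕜 := ℝ)] with x hx
    simp [partialDerivs, hx]

/-- The iterated partial derivative, along `L`, of the sum of the dyadic dilations
`∑ k < K, c k * g (2 ^ k • (x - x₀))`. -/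
noncomputable def dyadicSum {n : ℕ} (g : EuclideanSpace ℝ (Fin n) → ℝ)
    (x₀ : EuclideanSpace ℝ (Fin n)) (c : ℕ → ℝ) (K : ℕ) (L : List (Fin n))
    (x : EuclideanSpace ℝ (Fin n)) : ℝ :=
  ∑ k ∈ Finset.range K, c k * (2 ^ k) ^ L.length * partialDerivs g L ((2 : ℝ) ^ k • (x - x₀))

theorem contDiff_dyadicSum {n : ℕ} {g : EuclideanSpace ℝ (Fin n) → ℝ}
    (hg : ContDiff ℝ (⊤ : ℕ∞) g) (x₀ : EuclideanSpace ℝ (Fin n)) (c : ℕ → ℝ) (K : ℕ)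
    (L : List (Fin n)) : ContDiff ℝ (⊤ : ℕ∞) (dyadicSum g x₀ c K L) := by
  unfold dyadicSum
  have := contDiff_partialDerivs hg L
  fun_prop

theorem fderiv_dyadicSum {n : ℕ} {g : EuclideanSpace ℝ (Fin n) → ℝ}
    (hg : ContDiff ℝ (⊤ : ℕ∞) g) (x₀ : EuclideanSpace ℝ (Fin n)) (c : ℕ → ℝ) (K : ℕ)
    (L : List (Fin n)) (i : Fin n) (x : EuclideanSpace ℝ (Fin n)) :
    fderiv ℝ (dyadicSum g x₀ c K L) x (EuclideanSpace.single i (1 : ℝ)) =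
      dyadicSum g x₀ c K (i :: L) x := by
  have h : HasFDerivAt (dyadicSum g x₀ c K L)
      (∑ k ∈ Finset.range K, (c k * (2 ^ k) ^ L.length) •
        (fderiv ℝ (partialDerivs g L) ((2 : ℝ) ^ k • (x - x₀))).comp
          ((2 : ℝ) ^ k • ContinuousLinearMap.id ℝ (EuclideanSpace ℝ (Fin n)))) x := by
    unfold dyadicSum
    refine HasFDerivAt.fun_sum fun k _ => HasFDerivAt.const_mul ?_ _
    have h1 : HasFDerivAt (partialDerivs g L)
        (fderiv ℝ (partialDerivs g L) ((2 : ℝ) ^ k • (x - x₀))) ((2 : ℝ) ^ k • (x - x₀)) :=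
      ((contDiff_partialDerivs hg L).differentiable (by simp)).differentiableAt.hasFDerivAt
    exact h1.comp x (((hasFDerivAt_id x).sub_const x₀).const_smul ((2 : ℝ) ^ k))
  rw [h.fderiv]
  simp only [dyadicSum, sum_apply, smul_apply,
    ContinuousLinearMap.comp_apply, ContinuousLinearMap.id_apply, map_smul, smul_eq_mul,
    List.length_cons, partialDerivs]
  exact Finset.sum_congr rfl fun k _ => by ring

theorem integral_dyadicSum_mul_fderiv {n : ℕ} {g : EuclideanSpace ℝ (Fin n) → ℝ}
    (hg : ContDiff ℝ (⊤ : ℕ∞) g) (x₀ : EuclideanSpace ℝ (Fin n)) (c : ℕ → ℝ) (K : ℕ)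
    (L : List (Fin n)) (i : Fin n) {φ : EuclideanSpace ℝ (Fin n) → ℝ}
    (hφ : ContDiff ℝ (⊤ : ℕ∞) φ) (hφc : HasCompactSupport φ) :
    (∫ x, dyadicSum g x₀ c K L x * fderiv ℝ φ x (EuclideanSpace.single i (1 : ℝ))) =
      -∫ x, dyadicSum g x₀ c K (i :: L) x * φ x := by
  have hv := contDiff_dyadicSum hg x₀ c K L
  have hv' := contDiff_dyadicSum hg x₀ c K (i :: L)
  have hφ' : Continuous fun x => fderiv ℝ φ x (EuclideanSpace.single i (1 : ℝ)) :=
    (hφ.continuous_fderiv (by simp)).clm_apply continuous_const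
  have hφ'c : HasCompactSupport fun x => fderiv ℝ φ x (EuclideanSpace.single i (1 : ℝ)) :=
    hφc.fderiv_apply ℝ _
  rw [integral_mul_fderiv_eq_neg_fderiv_mul_of_integrable]
  · simp_rw [fderiv_dyadicSum hg]
  · simp_rw [fderiv_dyadicSum hg]
    exact (hv'.continuous.mul hφ.continuous).integrable_of_hasCompactSupport hφc.mul_left
  · exact (hv.continuous.mul hφ').integrable_of_hasCompactSupport hφ'c.mul_left
  · exact (hv.continuous.mul hφ.continuous).integrable_of_hasCompactSupport hφc.mul_left
  · exact fun x _ => hv.differentiable (by simp) x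
  · exact fun x _ => hφ.differentiable (by simp) x

theorem le_rearr {α : Type*} [MeasurableSpace α] {ν : Measure α} {u : α → ℝ} {t : ℝ}
    {s : ℝ≥0∞} (S : Set α) (hS : ENNReal.ofReal t < ν S)
    (h : ∀ x ∈ S, s ≤ ENNReal.ofReal |u x|) : s ≤ rearr ν u t := by
  refine le_sInf fun ρ hρ => ?_
  by_contra! hcon
  exact absurd (hS.trans_le ((measure_mono fun x hx => hcon.trans_le (h x hx)).trans hρ))
    (lt_irrefl _)

/-- A weighted integral of a non-increasing function is controlled by a dyadic sum. -/
theorem lintegral_le_dyadic_sum {n m : ℕ} (hn : 0 < n) (hmn : m < n) {f : ℝ → ℝ≥0∞}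
    (hf : AntitoneOn f (Ioo 0 1)) (hfin : ∀ t ∈ Ioo (0 : ℝ) 1, f t < ⊤) {a : ℝ} (ha0 : 0 < a)
    (ha1 : a < 1) (j : ℕ) :
    (∫⁻ s in Ioo (a / (2 ^ j) ^ n) 1, ENNReal.ofReal (s ^ ((m : ℝ) / n - 1)) * f s) ≤
      ENNReal.ofReal (2 ^ n * a ^ ((m : ℝ) / n - 1) *
        ∑ k ∈ Finset.range (j + 1), (f (a / (2 ^ k) ^ n)).toReal / (2 ^ k) ^ m) := by
  have hn' : (0 : ℝ) < n := by exact_mod_cast hn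
  have hq : (m : ℝ) / n - 1 ≤ 0 := by
    rw [sub_nonpos, div_le_one hn']
    exact_mod_cast hmn.le
  have hpos : ∀ k : ℕ, 0 < a / (2 ^ k) ^ n := fun k => by positivity
  have hlt : ∀ k : ℕ, a / (2 ^ k) ^ n < 1 := fun k =>
    lt_of_le_of_lt (div_le_self ha0.le (one_le_pow₀ (one_le_pow₀ one_le_two))) ha1
  have hI : ∀ α β : ℝ, 0 < α → α < 1 → 0 ≤ β →
      (∫⁻ s in Ioc α β ∩ Ioo 0 1, ENNReal.ofReal (s ^ ((m : ℝ) / n - 1)) * f s) ≤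
        ENNReal.ofReal (α ^ ((m : ℝ) / n - 1) * (f α).toReal * β) := by
    intro α β hα hα1 hβ
    calc (∫⁻ s in Ioc α β ∩ Ioo 0 1, ENNReal.ofReal (s ^ ((m : ℝ) / n - 1)) * f s)
        ≤ ∫⁻ _ in Ioc α β ∩ Ioo 0 1, ENNReal.ofReal (α ^ ((m : ℝ) / n - 1)) * f α := by
          refine setLIntegral_mono' (measurableSet_Ioc.inter measurableSet_Ioo) ?_
          rintro s ⟨⟨hs1, -⟩, hs3⟩
          exact mul_le_mul' (ENNReal.ofReal_le_ofReal
            (Real.rpow_le_rpow_of_nonpos hα hs1.le hq)) (hf ⟨hα, hα1⟩ hs3 hs1.le)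
      _ = ENNReal.ofReal (α ^ ((m : ℝ) / n - 1)) * f α * volume (Ioc α β ∩ Ioo 0 1) := by
          rw [setLIntegral_const]
      _ ≤ ENNReal.ofReal (α ^ ((m : ℝ) / n - 1)) * f α * ENNReal.ofReal β := by
          gcongr
          refine (measure_mono inter_subset_left).trans ?_
          rw [Real.volume_Ioc]
          exact ENNReal.ofReal_le_ofReal (by linarith)
      _ = _ := by
          rw [ENNReal.ofReal_mul (by positivity), ENNReal.ofReal_mul (by positivity),
            ENNReal.ofReal_toReal (hfin α ⟨hα, hα1⟩).ne]
  induction j with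
  | zero =>
    have h := hI a 1 ha0 ha1 zero_le_one
    have hsub : Ioo a 1 ⊆ Ioc a 1 ∩ Ioo 0 1 := fun s hs =>
      ⟨⟨hs.1, hs.2.le⟩, ⟨ha0.trans hs.1, hs.2⟩⟩
    simp only [pow_zero, one_pow, div_one, zero_add, Finset.range_one, Finset.sum_singleton]
    refine (lintegral_mono_set hsub).trans (h.trans (ENNReal.ofReal_le_ofReal ?_))
    rw [mul_one, mul_assoc]
    exact le_mul_of_one_le_left (by positivity) (one_le_pow₀ one_le_two)
  | succ j ih =>
    set α := a / (2 ^ (j + 1)) ^ n with hα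
    have hβ : a / (2 ^ j) ^ n = 2 ^ n * α := by
      rw [hα, pow_succ, mul_pow]
      field_simp
    have hsub : Ioo α 1 ⊆ (Ioc α (a / (2 ^ j) ^ n) ∩ Ioo 0 1) ∪ Ioo (a / (2 ^ j) ^ n) 1 := by
      intro s hs
      by_cases h : s ≤ a / (2 ^ j) ^ n
      · exact Or.inl ⟨⟨hs.1, h⟩, ⟨(hpos _).trans hs.1, hs.2⟩⟩
      · exact Or.inr ⟨not_le.1 h, hs.2⟩
    have hpow : α ^ ((m : ℝ) / n - 1) * α ≤ a ^ ((m : ℝ) / n - 1) / (2 ^ (j + 1)) ^ m := by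
      have h1 : α ^ ((m : ℝ) / n - 1) * α = α ^ ((m : ℝ) / n) := by
        rw [Real.rpow_sub_one (hpos _).ne']
        exact div_mul_cancel₀ _ (hpos _).ne'
      have h2 : (((2 : ℝ) ^ (j + 1)) ^ n) ^ ((m : ℝ) / n) = (2 ^ (j + 1)) ^ m := by
        rw [← Real.rpow_natCast _ n, ← Real.rpow_mul (by positivity),
          mul_div_cancel₀ _ hn'.ne', Real.rpow_natCast]
      rw [h1, hα, Real.div_rpow ha0.le (by positivity), h2]
      exact div_le_div_of_nonneg_right
        (Real.rpow_le_rpow_of_exponent_ge ha0 ha1.le (by linarith)) (by positivity)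
    refine (lintegral_mono_set hsub).trans ((lintegral_union_le _ _ _).trans ?_)
    rw [Finset.sum_range_succ, add_comm (Finset.sum _ _), mul_add, ENNReal.ofReal_add
      (by positivity) (by positivity)]
    refine add_le_add ((hI _ _ (hpos _) (hlt _) (hpos _).le).trans
      (ENNReal.ofReal_le_ofReal ?_)) ih
    rw [hβ]
    calc α ^ ((m : ℝ) / n - 1) * (f α).toReal * (2 ^ n * α)
        = 2 ^ n * (f α).toReal * (α ^ ((m : ℝ) / n - 1) * α) := by ring
      _ ≤ 2 ^ n * (f α).toReal * (a ^ ((m : ℝ) / n - 1) / (2 ^ (j + 1)) ^ m) := by gcongr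
      _ = _ := by ring

theorem ContDiffBump.partialDerivs_eq_zero {n : ℕ}
    (g : ContDiffBump (0 : EuclideanSpace ℝ (Fin n))) {L : List (Fin n)} (hL : L ≠ [])
    {y : EuclideanSpace ℝ (Fin n)} (hy : ‖y‖ < g.rIn ∨ g.rOut < ‖y‖) :
    partialDerivs g L y = 0 := by
  rcases hy with hy | hy
  · exact (partialDerivs_eventuallyEq_zero (c := 1)
      (g.eventuallyEq_one_of_mem_ball (by simpa using hy)) hL).self_of_nhds
  · refine (partialDerivs_eventuallyEq_zero (c := 0) ?_ hL).self_of_nhds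
    filter_upwards [(isOpen_lt continuous_const continuous_norm).mem_nhds hy] with z hz
    exact g.zero_of_le_dist (by simpa using (le_of_lt hz))

theorem ContDiffBump.exists_partialDerivs_le {n m : ℕ} (hm : 1 ≤ m)
    (g : ContDiffBump (0 : EuclideanSpace ℝ (Fin n))) :
    ∃ D : ℝ, 0 ≤ D ∧ ∀ (j : Fin m → Fin n) y, |partialDerivs g (List.ofFn j) y| ≤ D := by
  have h : ∀ j : Fin m → Fin n, ∃ D : ℝ, ∀ y, ‖partialDerivs g (List.ofFn j) y‖ ≤ D := by
    intro j
    refine HasCompactSupport.exists_bound_of_continuous ?_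
      (contDiff_partialDerivs g.contDiff _).continuous
    refine HasCompactSupport.intro (isCompact_closedBall 0 g.rOut) fun y hy => ?_
    refine g.partialDerivs_eq_zero ?_ (Or.inr (by simpa using hy))
    rw [← List.length_pos_iff, List.length_ofFn]
    exact hm
  choose D hD using h
  have hD0 : ∀ j, 0 ≤ D j := fun j => (norm_nonneg _).trans (hD j 0)
  exact ⟨∑ j, D j, Finset.sum_nonneg fun j _ => hD0 j, fun j y =>
    (hD j y).trans (Finset.single_le_sum (fun j _ => hD0 j) (Finset.mem_univ j))⟩

theorem ContDiffBump.abs_dyadicSum_le {n m : ℕ} (hm : 1 ≤ m)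
    (g : ContDiffBump (0 : EuclideanSpace ℝ (Fin n))) (hg : g.rOut < 2 * g.rIn)
    {L : List (Fin n)} (hL : L.length = m) {D : ℝ} (hD : ∀ y, |partialDerivs g L y| ≤ D)
    {F : ℕ → ℝ} (hF : ∀ k, 0 ≤ F k) {K : ℕ} {T : ℝ} (hT : 0 ≤ T)
    {x₀ x : EuclideanSpace ℝ (Fin n)}
    (h : ∀ k ∈ Finset.range K, 2 ^ k * ‖x - x₀‖ ≤ g.rOut → F k ≤ T) :
    |dyadicSum g x₀ (fun k => F k / (2 ^ k) ^ m) K L x| ≤ D * T := by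
  have hD0 : 0 ≤ D := (abs_nonneg _).trans (hD 0)
  have hL' : L ≠ [] := by
    rw [← List.length_pos_iff, hL]
    exact hm
  have hnorm : ∀ k : ℕ, ‖(2 : ℝ) ^ k • (x - x₀)‖ = 2 ^ k * ‖x - x₀‖ := fun k => by
    rw [norm_smul, Real.norm_of_nonneg (by positivity)]
  have hz : ∀ k : ℕ, partialDerivs g L ((2 : ℝ) ^ k • (x - x₀)) ≠ 0 →
      g.rIn ≤ 2 ^ k * ‖x - x₀‖ ∧ 2 ^ k * ‖x - x₀‖ ≤ g.rOut := by
    intro k hk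
    rw [← hnorm]
    by_contra hcon
    refine hk (g.partialDerivs_eq_zero hL' ?_)
    by_contra! hcon'
    exact hcon hcon'
  have hinj : ∀ k l : ℕ, k < l → g.rIn ≤ 2 ^ k * ‖x - x₀‖ → ¬ 2 ^ l * ‖x - x₀‖ ≤ g.rOut := by
    intro k l hkl h1 h2
    have h3 : (2 : ℝ) ^ (k + 1) ≤ 2 ^ l := pow_le_pow_right₀ one_le_two hkl
    have h4 := mul_le_mul_of_nonneg_right h3 (norm_nonneg (x - x₀))
    rw [pow_succ] at h4
    linarith
  have hterm : ∀ k : ℕ, F k / (2 ^ k) ^ m * (2 ^ k) ^ L.length *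
      partialDerivs g L ((2 : ℝ) ^ k • (x - x₀)) =
        F k * partialDerivs g L ((2 : ℝ) ^ k • (x - x₀)) := fun k => by
    rw [hL, div_mul_cancel₀ _ (by positivity)]
  simp only [dyadicSum, hterm]
  by_cases hall : ∀ k ∈ Finset.range K, partialDerivs g L ((2 : ℝ) ^ k • (x - x₀)) = 0
  · rw [Finset.sum_eq_zero fun k hk => by rw [hall k hk, mul_zero], abs_zero]
    positivity
  · push Not at hall
    obtain ⟨k, hk, hne⟩ := hall
    have hk' := hz k hne
    rw [Finset.sum_eq_single_of_mem k hk]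
    · rw [abs_mul, abs_of_nonneg (hF k), mul_comm]
      exact mul_le_mul (hD _) (h k hk hk'.2) (hF k) hD0
    · intro l _ hlk
      by_contra hne'
      have hl' := hz l (right_ne_zero_of_mul hne')
      rcases lt_or_gt_of_ne hlk with hlt | hlt
      · exact hinj l k hlt hl'.1 hk'.2
      · exact hinj k l hlt hk'.1 hl'.2

theorem ContDiffBump.exists_gradient_bound {n m : ℕ} (hm : 1 ≤ m)
    (g : ContDiffBump (0 : EuclideanSpace ℝ (Fin n))) (hg : g.rOut < 2 * g.rIn) :
    ∃ B : ℝ, 0 ≤ B ∧ ∀ (F : ℕ → ℝ), (∀ k, 0 ≤ F k) → ∀ (K : ℕ) (T : ℝ), 0 ≤ T →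
      ∀ x₀ x : EuclideanSpace ℝ (Fin n),
      (∀ k ∈ Finset.range K, 2 ^ k * ‖x - x₀‖ ≤ g.rOut → F k ≤ T) →
      Real.sqrt (∑ j : Fin m → Fin n,
        dyadicSum g x₀ (fun k => F k / (2 ^ k) ^ m) K (List.ofFn j) x ^ 2) ≤ B * T := by
  obtain ⟨D, hD0, hD⟩ := g.exists_partialDerivs_le hm
  refine ⟨Real.sqrt (Fintype.card (Fin m → Fin n)) * D, by positivity, ?_⟩
  intro F hF K T hT x₀ x h
  rw [Real.sqrt_le_left (by positivity), mul_pow, mul_pow, Real.sq_sqrt (by positivity)]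
  refine (Finset.sum_le_card_nsmul _ _ ((D * T) ^ 2) fun j _ => ?_).trans ?_
  · exact sq_le_sq' (abs_le.1 (g.abs_dyadicSum_le hm hg List.length_ofFn (hD j) hF hT h)).1
      (abs_le.1 (g.abs_dyadicSum_le hm hg List.length_ofFn (hD j) hF hT h)).2
  · rw [Finset.card_univ, nsmul_eq_mul, mul_pow, mul_assoc]

/-- The rearrangement of the `m`-th order gradient of a dyadic sum is controlled by `f`. -/
theorem rearr_gradient_le {n m : ℕ} (hn : 0 < n)
    {g : ContDiffBump (0 : EuclideanSpace ℝ (Fin n))}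
    {B : ℝ} (hB0 : 0 ≤ B) (hB : ∀ (F : ℕ → ℝ), (∀ k, 0 ≤ F k) → ∀ (K : ℕ) (T : ℝ), 0 ≤ T →
      ∀ x₀ x : EuclideanSpace ℝ (Fin n),
      (∀ k ∈ Finset.range K, 2 ^ k * ‖x - x₀‖ ≤ g.rOut → F k ≤ T) →
      Real.sqrt (∑ j : Fin m → Fin n,
        dyadicSum g x₀ (fun k => F k / (2 ^ k) ^ m) K (List.ofFn j) x ^ 2) ≤ B * T)
    {f : ℝ → ℝ≥0∞} (hf : AntitoneOn f (Ioo 0 1)) (hfin : ∀ t ∈ Ioo (0 : ℝ) 1, f t < ⊤)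
    {a : ℝ} (ha0 : 0 < a) (ha1 : a < 1) (Ω : Set (EuclideanSpace ℝ (Fin n)))
    {V : ℝ} (hV : volume (Metric.closedBall (0 : EuclideanSpace ℝ (Fin n)) g.rOut) =
      ENNReal.ofReal (a * V))
    (x₀ : EuclideanSpace ℝ (Fin n)) (K : ℕ) {t : ℝ} (ht : t ∈ Ioo (0 : ℝ) 1) :
    rearr (volume.restrict Ω) (fun x => Real.sqrt (∑ j : Fin m → Fin n,
      dyadicSum g x₀ (fun k => (f (a / (2 ^ k) ^ n)).toReal / (2 ^ k) ^ m) K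
        (List.ofFn j) x ^ 2)) (V * t) ≤ ENNReal.ofReal B * f t := by
  have hn' : (n : ℝ) ≠ 0 := by exact_mod_cast hn.ne'
  have hmem : ∀ k : ℕ, a / (2 ^ k) ^ n ∈ Ioo (0 : ℝ) 1 := fun k => ⟨by positivity,
    lt_of_le_of_lt (div_le_self ha0.le (one_le_pow₀ (one_le_pow₀ one_le_two))) ha1⟩
  set r : ℝ := (t / a) ^ ((n : ℝ)⁻¹) with hr
  have hta : 0 < t / a := div_pos ht.1 ha0
  have hr0 : 0 ≤ r := by positivity
  have hrn : r ^ n = t / a := Real.rpow_inv_natCast_pow hta.le hn.ne'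
  have hvol : volume (Metric.closedBall x₀ (r * g.rOut)) = ENNReal.ofReal (V * t) := by
    have hpos := g.rOut_pos
    rw [Measure.addHaar_closedBall _ _ hpos.le, finrank_euclideanSpace_fin] at hV
    rw [Measure.addHaar_closedBall _ _ (by positivity), finrank_euclideanSpace_fin, mul_pow,
      ENNReal.ofReal_mul (by positivity), mul_assoc,
      hV, hrn, ← ENNReal.ofReal_mul hta.le]
    congr 1
    field_simp
  refine sInf_le ?_
  rw [mem_ofPred_eq, ← hvol]
  refine (Measure.restrict_apply_le _ _).trans (measure_mono fun x hx => ?_)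
  rw [mem_ofPred_eq, abs_of_nonneg (Real.sqrt_nonneg _),
    ← ENNReal.ofReal_toReal (hfin t ht).ne, ← ENNReal.ofReal_mul hB0] at hx
  by_contra hxb
  refine absurd hx (not_lt.2 (ENNReal.ofReal_le_ofReal ?_))
  refine hB _ (fun k => ENNReal.toReal_nonneg) K _ ENNReal.toReal_nonneg x₀ x fun k _ hk => ?_
  refine ENNReal.toReal_mono (hfin t ht).ne (hf ht (hmem k) ?_)
  rw [Metric.mem_closedBall, dist_eq_norm, not_le] at hxb
  have h1 : 2 ^ k * r < 1 := by
    have h2 : 2 ^ k * (r * g.rOut) < g.rOut :=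
      lt_of_lt_of_le ((mul_lt_mul_iff_right₀ (by positivity)).2 hxb) hk
    rw [← mul_assoc] at h2
    exact lt_of_mul_lt_mul_right (by simpa using h2) g.rOut_pos.le
  have h3 : (2 ^ k * r) ^ n ≤ 1 := pow_le_one₀ (by positivity) h1.le
  rw [mul_pow, hrn] at h3
  rw [le_div_iff₀ (by positivity)]
  rw [← mul_div_assoc, div_le_one ha0] at h3
  linarith

/-- The rearrangement of a dyadic sum dominates the Hardy-type operator, up to a dilation. -/
theorem S1_le_rearr_dyadicSum {n m : ℕ} (hn : 0 < n) (hmn : m < n) {d : ℝ} (hd0 : 0 < d)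
    (g : ContDiffBump (0 : EuclideanSpace ℝ (Fin n)))
    {f : ℝ → ℝ≥0∞} (hf : AntitoneOn f (Ioo 0 1)) (hfin : ∀ t ∈ Ioo (0 : ℝ) 1, f t < ⊤)
    {a : ℝ} (ha0 : 0 < a) (ha1 : a < 1) {ν : Measure (EuclideanSpace ℝ (Fin n))}
    {x₀ : EuclideanSpace ℝ (Fin n)} {M κ : ℝ} (hM : 0 < M)
    (hν : ∀ j : ℕ, ENNReal.ofReal (M * κ * ((2 : ℝ) ^ (-d)) ^ j) ≤
      ν (Metric.ball x₀ (g.rIn / 2 ^ j)))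
    {p : ℕ} (hp : (2 : ℝ) ^ d ≤ 2 ^ p * κ) (K : ℕ) {t : ℝ} (ht : t ∈ Ioo (0 : ℝ) 1)
    (hKt : a ^ (d / n) * ((2 : ℝ) ^ (-d)) ^ K ≤ t) :
    S1 n m d f t ≤ ENNReal.ofReal (2 ^ n * a ^ ((m : ℝ) / n - 1)) *
      rearr ν (dyadicSum g x₀ (fun k => (f (a / (2 ^ k) ^ n)).toReal / (2 ^ k) ^ m) (K + 1) [])
        (M * (t / 2 ^ p)) := by
  classical
  have hn' : (0 : ℝ) < n := by exact_mod_cast hn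
  set δ : ℝ := (2 : ℝ) ^ (-d) with hδ
  have hδ0 : 0 < δ := by positivity
  have hδ2 : (2 : ℝ) ^ d * δ = 1 := by
    rw [hδ, ← Real.rpow_add two_pos, add_neg_cancel, Real.rpow_zero]
  have hex : ∃ j : ℕ, a ^ (d / n) * δ ^ j ≤ t := ⟨K, hKt⟩
  set j := Nat.find hex with hj
  have hjK : j ≤ K := Nat.find_min' hex hKt
  have hjt : a ^ (d / n) * δ ^ j ≤ t := Nat.find_spec hex
  have hlt : t < 2 ^ d * δ ^ j := by
    rcases Nat.eq_zero_or_pos j with h0 | h0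
    · rw [h0, pow_zero, mul_one]
      exact ht.2.trans_le (Real.one_le_rpow one_le_two hd0.le)
    · have h1 := Nat.find_min hex (m := j - 1) (by omega)
      rw [not_le] at h1
      have h2 : (2 : ℝ) ^ d * δ ^ j = δ ^ (j - 1) := by
        conv_lhs => rw [← Nat.sub_add_cancel h0, pow_succ']
        rw [← mul_assoc, hδ2, one_mul]
      rw [h2]
      refine h1.trans_le (mul_le_of_le_one_left (by positivity) ?_)
      exact Real.rpow_le_one ha0.le ha1.le (by positivity)
  have hpow : a / (2 ^ j) ^ n ≤ t ^ ((n : ℝ) / d) := by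
    have h1 := Real.rpow_le_rpow (by positivity) hjt (z := (n : ℝ) / d) (by positivity)
    refine le_trans (le_of_eq ?_) h1
    have h2 : d / n * (n / d) = 1 := by field_simp
    have h3 : δ ^ j = ((2 : ℝ) ^ j) ^ (-d) := by
      rw [hδ, ← Real.rpow_natCast, ← Real.rpow_natCast, ← Real.rpow_mul two_pos.le,
        ← Real.rpow_mul two_pos.le, mul_comm]
    have h4 : -d * (n / d) = -(n : ℝ) := by field_simp
    rw [Real.mul_rpow (by positivity) (by positivity), ← Real.rpow_mul ha0.le, h2,
      Real.rpow_one, h3, ← Real.rpow_mul (by positivity), h4, Real.rpow_neg (by positivity),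
      Real.rpow_natCast, div_eq_mul_inv]
  set F : ℕ → ℝ := fun k => (f (a / (2 ^ k) ^ n)).toReal / (2 ^ k) ^ m with hF
  have hF0 : ∀ k, 0 ≤ F k := fun k => by positivity
  have hrearr : ENNReal.ofReal (∑ k ∈ Finset.range (j + 1), F k) ≤
      rearr ν (dyadicSum g x₀ F (K + 1) []) (M * (t / 2 ^ p)) := by
    refine le_rearr (Metric.ball x₀ (g.rIn / 2 ^ j)) (lt_of_lt_of_le ?_ (hν j)) fun x hx => ?_
    · have h2 : M * (t / 2 ^ p) < M * κ * δ ^ j := by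
        rw [mul_assoc]
        refine mul_lt_mul_of_pos_left ?_ hM
        rw [div_lt_iff₀ (by positivity)]
        calc t < 2 ^ d * δ ^ j := hlt
          _ ≤ 2 ^ p * κ * δ ^ j := by gcongr
          _ = κ * δ ^ j * 2 ^ p := by ring
      have h3 : 0 < M * (t / 2 ^ p) := mul_pos hM (div_pos ht.1 (by positivity))
      exact (ENNReal.ofReal_lt_ofReal_iff (h3.trans h2)).2 h2
    · refine ENNReal.ofReal_le_ofReal (le_trans ?_ (le_abs_self _))
      have hone : ∀ k ∈ Finset.range (j + 1), g ((2 : ℝ) ^ k • (x - x₀)) = 1 := by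
        intro k hk
        refine g.one_of_mem_closedBall ?_
        rw [Finset.mem_range, Nat.lt_succ_iff] at hk
        rw [Metric.mem_ball, dist_eq_norm, lt_div_iff₀ (by positivity)] at hx
        rw [mem_closedBall_zero_iff, norm_smul, Real.norm_of_nonneg (by positivity)]
        have h5 : (2 : ℝ) ^ k ≤ 2 ^ j := pow_le_pow_right₀ one_le_two hk
        have h6 := mul_le_mul_of_nonneg_right h5 (norm_nonneg (x - x₀))
        linarith
      simp only [dyadicSum, partialDerivs, List.length_nil, pow_zero, mul_one]
      calc ∑ k ∈ Finset.range (j + 1), F k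
          = ∑ k ∈ Finset.range (j + 1), F k * g ((2 : ℝ) ^ k • (x - x₀)) :=
            Finset.sum_congr rfl fun k hk => by rw [hone k hk, mul_one]
        _ ≤ _ := Finset.sum_le_sum_of_subset_of_nonneg
            (Finset.range_mono (Nat.succ_le_succ hjK))
            fun k _ _ => mul_nonneg (hF0 k) g.nonneg
  calc S1 n m d f t
      ≤ ∫⁻ s in Ioo (a / (2 ^ j) ^ n) 1, ENNReal.ofReal (s ^ ((m : ℝ) / n - 1)) * f s :=
        lintegral_mono_set (Ioo_subset_Ioo_left hpow)
    _ ≤ _ := lintegral_le_dyadic_sum hn hmn hf hfin ha0 ha1 j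
    _ = ENNReal.ofReal (2 ^ n * a ^ ((m : ℝ) / n - 1)) *
          ENNReal.ofReal (∑ k ∈ Finset.range (j + 1), F k) :=
        ENNReal.ofReal_mul (by positivity)
    _ ≤ _ := by gcongr

/-- **Necessity of the Hardy-type inequality.** If the Sobolev trace inequality holds for
every nonnegative `m`-times weakly differentiable function supported in a closed ball
around a point `x₀` at which `μ` decays exactly like `r^d`, then the one-dimensional
Hardy-type inequality for `S₁` holds. -/
theorem necessity_of_hardy (n m : ℕ) (hn : 2 ≤ n) (hm : 1 ≤ m) (hmn : m < n)
    (d : ℝ) (hd0 : 0 < d) (hdn : d ≤ n)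
    (Ω : Set (EuclideanSpace ℝ (Fin n))) (hΩ : IsOpen Ω) (hΩvol : volume Ω < ⊤)
    (NX NY : (ℝ → ℝ≥0∞) → ℝ≥0∞) (hX : IsRINorm NX) (hY : IsRINorm NY)
    (μ : Measure (EuclideanSpace ℝ (Fin n))) (hfin : IsFiniteMeasure μ) (hsupp : μ Ωᶜ = 0)
    (hFrostman : ∃ A : ℝ, ∀ (x : EuclideanSpace ℝ (Fin n)) (r : ℝ), 0 < r →
        μ (Metric.ball x r ∩ Ω) ≤ ENNReal.ofReal (A * r ^ d))
    (x₀ : EuclideanSpace ℝ (Fin n)) (R : ℝ) (hR : 0 < R)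
    (hball : Metric.closedBall x₀ R ⊆ Ω)
    (hlower : ∃ c : ℝ, 0 < c ∧ ∀ r : ℝ, 0 < r → r ≤ R →
        ENNReal.ofReal (c * r ^ d) ≤ μ (Metric.ball x₀ r ∩ Ω))
    (C₂ : ℝ)
    (hSob : ∀ (u : EuclideanSpace ℝ (Fin n) → ℝ)
        (v : List (Fin n) → EuclideanSpace ℝ (Fin n) → ℝ),
        (∀ x, 0 ≤ u x) → tsupport u ⊆ Metric.closedBall x₀ R →
        ContinuousOn u {x₀}ᶜ →
        v [] = u →
        (∀ L : List (Fin n), L.length ≤ m → LocallyIntegrable (v L) volume) →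
        (∀ L : List (Fin n), L.length < m → ∀ i : Fin n,
          ∀ φ : EuclideanSpace ℝ (Fin n) → ℝ, ContDiff ℝ (⊤ : ℕ∞) φ →
            HasCompactSupport φ →
            (∫ x, v L x * fderiv ℝ φ x (EuclideanSpace.single i (1 : ℝ))) =
              -∫ x, v (i :: L) x * φ x) →
        NY (fun t => rearr μ u ((μ Ω).toReal * t)) ≤
          ENNReal.ofReal C₂ *
            NX (fun t => rearr (volume.restrict Ω)
              (fun x => Real.sqrt (∑ j : Fin m → Fin n, (v (List.ofFn j) x) ^ 2))
              ((volume Ω).toReal * t))) :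
    ∃ C₁ : ℝ, ∀ f : ℝ → ℝ≥0∞, Measurable f → AntitoneOn f (Set.Ioo 0 1) →
      NY (S1 n m d f) ≤ ENNReal.ofReal C₁ * NX f := by
  have hn0 : 0 < n := by omega
  obtain ⟨c, hc, hlow⟩ := hlower
  -- a bump function whose support lies strictly inside the ball
  let g : ContDiffBump (0 : EuclideanSpace ℝ (Fin n)) :=
    ⟨R / 2, 3 * R / 4, by positivity, by linarith⟩
  have hgin : g.rIn = R / 2 := rfl
  have hgout : g.rOut = 3 * R / 4 := rfl
  obtain ⟨B, hB0, hB⟩ := g.exists_gradient_bound hm (by rw [hgin, hgout]; linarith)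
  -- the total masses
  set V : ℝ := (volume Ω).toReal with hV
  set M : ℝ := (μ Ω).toReal with hM
  have hMlow : c * R ^ d ≤ M := by
    rw [hM, ← ENNReal.ofReal_le_iff_le_toReal (measure_ne_top _ _)]
    exact (hlow R hR le_rfl).trans (measure_mono inter_subset_right)
  have hM0 : 0 < M := lt_of_lt_of_le (by positivity) hMlow
  set ω : ℝ := (volume (Metric.ball (0 : EuclideanSpace ℝ (Fin n)) 1)).toReal with hω
  have hω' : volume (Metric.ball (0 : EuclideanSpace ℝ (Fin n)) 1) = ENNReal.ofReal ω :=
    (ENNReal.ofReal_toReal measure_ball_lt_top.ne).symm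
  have hω0 : 0 < ω :=
    ENNReal.toReal_pos (Metric.measure_ball_pos _ _ one_pos).ne' measure_ball_lt_top.ne
  have hVlow : ω * R ^ n ≤ V := by
    rw [hV, ← ENNReal.ofReal_le_iff_le_toReal hΩvol.ne, mul_comm,
      ENNReal.ofReal_mul (by positivity), ← hω']
    refine le_trans (le_of_eq ?_) (measure_mono hball)
    rw [Measure.addHaar_closedBall _ _ hR.le, finrank_euclideanSpace_fin]
  have hV0 : 0 < V := lt_of_lt_of_le (by positivity) hVlow
  set a : ℝ := ω * (3 * R / 4) ^ n / V with ha
  have ha0 : 0 < a := by positivity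
  have ha1 : a < 1 := by
    rw [ha, div_lt_one hV0]
    refine lt_of_lt_of_le (mul_lt_mul_of_pos_left ?_ hω0) hVlow
    exact pow_lt_pow_left₀ (by linarith) (by positivity) hn0.ne'
  have hVa : volume (Metric.closedBall (0 : EuclideanSpace ℝ (Fin n)) g.rOut) =
      ENNReal.ofReal (a * V) := by
    rw [ha, div_mul_cancel₀ _ hV0.ne', Measure.addHaar_closedBall _ _ g.rOut_pos.le, hω',
      finrank_euclideanSpace_fin, ← ENNReal.ofReal_mul (pow_nonneg g.rOut_pos.le n), hgout,
      mul_comm]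
  set κ : ℝ := c * (R / 2) ^ d / M with hκ
  have hκ0 : 0 < κ := by positivity
  have hν : ∀ j : ℕ, ENNReal.ofReal (M * κ * ((2 : ℝ) ^ (-d)) ^ j) ≤
      μ (Metric.ball x₀ (g.rIn / 2 ^ j)) := by
    intro j
    have hr0 : 0 < g.rIn / 2 ^ j := div_pos g.rIn_pos (by positivity)
    have hrR : g.rIn / 2 ^ j ≤ R := by
      refine (div_le_self g.rIn_pos.le (one_le_pow₀ one_le_two)).trans ?_
      rw [hgin]; linarith
    refine le_trans (le_of_eq ?_) ((hlow _ hr0 hrR).trans (measure_mono inter_subset_left))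
    congr 1
    rw [hgin, Real.div_rpow (by positivity) (by positivity), hκ, mul_div_cancel₀ _ hM0.ne',
      Real.rpow_neg two_pos.le, inv_pow, ← Real.rpow_natCast (2 ^ d), ← Real.rpow_mul two_pos.le,
      ← Real.rpow_natCast 2, ← Real.rpow_mul two_pos.le, mul_comm d]
    ring
  obtain ⟨p, hp⟩ : ∃ p : ℕ, (2 : ℝ) ^ d ≤ 2 ^ p * κ := by
    obtain ⟨p, hp⟩ := pow_unbounded_of_one_lt ((2 : ℝ) ^ d / κ) one_lt_two
    exact ⟨p, by rw [div_lt_iff₀ hκ0] at hp; exact hp.le⟩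
  set C : ℝ := 2 ^ n * a ^ ((m : ℝ) / n - 1) with hC
  have hC0 : 0 ≤ C := by positivity
  refine ⟨C * (2 ^ p * (|C₂| * B)) + 1, fun f _ hf => ?_⟩
  by_cases hNX : NX f = ⊤
  · rw [hNX, ENNReal.mul_top]
    · exact le_top
    · exact (ENNReal.ofReal_pos.2 (by positivity)).ne'
  have hfin : ∀ t ∈ Ioo (0 : ℝ) 1, f t < ⊤ := fun t ht => hX.lt_top_of_antitoneOn hf hNX ht
  set F : ℕ → ℝ := fun k => (f (a / (2 ^ k) ^ n)).toReal / (2 ^ k) ^ m with hF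
  have hF0 : ∀ k, 0 ≤ F k := fun k => by positivity
  have hgs : ContDiff ℝ (⊤ : ℕ∞) g := g.contDiff
  -- the trace inequality for the dyadic sums
  have hSobK : ∀ K : ℕ, NY (fun t => rearr μ (dyadicSum g x₀ F K []) (M * t)) ≤
      ENNReal.ofReal C₂ * (ENNReal.ofReal B * NX f) := by
    intro K
    refine (hSob (dyadicSum g x₀ F K []) (dyadicSum g x₀ F K) ?_ ?_ ?_ rfl ?_ ?_).trans ?_
    · intro x
      simp only [dyadicSum, partialDerivs, List.length_nil, pow_zero, mul_one]
      exact Finset.sum_nonneg fun k _ => mul_nonneg (hF0 k) g.nonneg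
    · refine closure_minimal (fun x hx => ?_) Metric.isClosed_closedBall
      by_contra hxR
      rw [Metric.mem_closedBall, dist_eq_norm, not_le] at hxR
      refine hx ?_
      simp only [dyadicSum, partialDerivs, List.length_nil, pow_zero, mul_one]
      refine Finset.sum_eq_zero fun k _ => ?_
      rw [g.zero_of_le_dist, mul_zero]
      rw [dist_zero_right, norm_smul, Real.norm_of_nonneg (by positivity), hgout]
      have h1 : (1 : ℝ) ≤ 2 ^ k := one_le_pow₀ one_le_two
      have h2 := mul_le_mul_of_nonneg_right h1 (norm_nonneg (x - x₀))
      linarith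
    · exact (contDiff_dyadicSum hgs x₀ F K []).continuous.continuousOn
    · exact fun L _ => (contDiff_dyadicSum hgs x₀ F K L).continuous.locallyIntegrable
    · exact fun L _ i φ hφ hφc => integral_dyadicSum_mul_fderiv hgs x₀ F K L i hφ hφc
    · gcongr
      refine (hX.mono _ (fun t => ENNReal.ofReal B * f t) ?_).trans (hX.smul _ _).le
      exact (ae_restrict_iff' measurableSet_Ioo).2 (ae_of_all _ fun t ht =>
        rearr_gradient_le hn0 hB0 hB hf hfin ha0 ha1 Ω hVa x₀ K ht)
  -- truncations of `S1 f`
  set δ : ℝ := (2 : ℝ) ^ (-d) with hδ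
  have hδ0 : 0 < δ := by positivity
  have hδ1 : δ < 1 := Real.rpow_lt_one_of_one_lt_of_neg one_lt_two (by linarith)
  have had : 0 < a ^ (d / n) := by positivity
  have hsup : NY (S1 n m d f) =
      ⨆ K : ℕ, NY (fun t => if a ^ (d / n) * δ ^ K ≤ t then S1 n m d f t else 0) := by
    refine hY.iSup_eq _ _ (fun K => ae_of_all _ fun t => ?_)
      ((ae_restrict_iff' measurableSet_Ioo).2 (ae_of_all _ fun t ht => ?_))
    · have h1 : a ^ (d / n) * δ ^ (K + 1) ≤ a ^ (d / n) * δ ^ K :=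
        mul_le_mul_of_nonneg_left (pow_le_pow_of_le_one hδ0.le hδ1.le (Nat.le_succ K)) had.le
      by_cases h : a ^ (d / n) * δ ^ K ≤ t
      · rw [if_pos h, if_pos (h1.trans h)]
      · rw [if_neg h]
        exact zero_le
    · refine le_antisymm (iSup_le fun K => ?_) ?_
      · split_ifs
        · exact le_rfl
        · exact zero_le
      · obtain ⟨K, hK⟩ := exists_pow_lt_of_lt_one (div_pos ht.1 had) hδ1
        rw [lt_div_iff₀ had, mul_comm] at hK
        refine le_iSup_of_le K ?_
        rw [if_pos hK.le]
  rw [hsup]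
  refine iSup_le fun K => ?_
  calc NY (fun t => if a ^ (d / n) * δ ^ K ≤ t then S1 n m d f t else 0)
      ≤ NY (fun t => ENNReal.ofReal C *
          rearr μ (dyadicSum g x₀ F (K + 1) []) (M * (t / 2 ^ p))) := by
        refine hY.mono _ _ ((ae_restrict_iff' measurableSet_Ioo).2 (ae_of_all _ fun t ht => ?_))
        split_ifs with h
        · exact S1_le_rearr_dyadicSum hn0 hmn hd0 g hf hfin ha0 ha1 hM0 hν hp K ht h
        · exact zero_le
    _ = ENNReal.ofReal C *
          NY (fun t => rearr μ (dyadicSum g x₀ F (K + 1) []) (M * (t / 2 ^ p))) :=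
        hY.smul _ _
    _ ≤ ENNReal.ofReal C *
          (2 ^ p * NY (fun t => rearr μ (dyadicSum g x₀ F (K + 1) []) (M * t))) := by
        gcongr
        exact hY.dilate_two_pow_le p
          (fun t => rearr μ (dyadicSum g x₀ F (K + 1) []) (M * t))
    _ ≤ ENNReal.ofReal C * (2 ^ p * (ENNReal.ofReal C₂ * (ENNReal.ofReal B * NX f))) := by
        gcongr
        exact hSobK (K + 1)
    _ ≤ ENNReal.ofReal C * (2 ^ p * (ENNReal.ofReal |C₂| * (ENNReal.ofReal B * NX f))) := by
        gcongr
        exact le_abs_self C₂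
    _ = ENNReal.ofReal (C * (2 ^ p * (|C₂| * B))) * NX f := by
        rw [ENNReal.ofReal_mul hC0,
          ENNReal.ofReal_mul (q := |C₂| * B) (pow_nonneg two_pos.le p),
          ENNReal.ofReal_mul (abs_nonneg _), ENNReal.ofReal_pow two_pos.le, ENNReal.ofReal_ofNat]
        ring
    _ ≤ ENNReal.ofReal (C * (2 ^ p * (|C₂| * B)) + 1) * NX f := by
        gcongr
        linarith
end

section
/- Let n ≥ 2, let m ∈ ℕ with m < n, and let d ∈ (0, n]. Let ‖·‖_X and ‖·‖_Z be rearrangement-invariant function norms on (0,1), with associate norms ‖·‖_{X'} and ‖·‖_{Z'}. Suppose there is a constant C such that ‖ t ↦ ∫_{t^{n/d}}^1 f(s) s^{−1+m/n} ds ‖_Z ≤ C ‖f‖_X for every nonnegative measurable f on (0,1). Then ‖ t ↦ t^{−1+m/n} ∫₀^{t^{d/n}} f*(s) ds ‖_{X'} ≤ C ‖f‖_{Z'} for every nonnegative measurable f on (0,1), where f* is the non-increasing rearrangement of f with respect to Lebesgue measure. (This duality statement is the key step proving the optimality of the target norm ‖·‖_{X^m_{d,n}} defined by ‖f‖_{(X^m_{d,n})'}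 = ‖ t^{−1+m/n} ∫₀^{t^{d/n}} f*(s) ds ‖_{X'}.) -/
open MeasureTheory Set
open scoped ENNReal NNReal

/-- The associate norm of a function norm on `(0,1)`. -/
noncomputable def assocNorm (N : (ℝ → ℝ≥0∞) → ℝ≥0∞) (g : ℝ → ℝ≥0∞) : ℝ≥0∞ :=
  ⨆ (f : ℝ → ℝ≥0∞) (_ : Measurable f) (_ : N f ≤ 1), ∫⁻ t in Set.Ioo (0 : ℝ) 1, f t * g t

theorem IsRINorm.lintegral_mul_le {N : (ℝ → ℝ≥0∞) → ℝ≥0∞} (hN : IsRINorm N)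
    {k : ℝ → ℝ≥0∞} (hk : Measurable k) (hkt : N k ≠ ⊤) (f : ℝ → ℝ≥0∞) :
    ∫⁻ t in Ioo (0 : ℝ) 1, k t * f t ≤ N k * assocNorm N f := by
  rcases eq_or_ne (N k) 0 with h0 | h0
  · have hae : ∀ᵐ t ∂(volume.restrict (Ioo (0 : ℝ) 1)), k t * f t = 0 := by
      filter_upwards [(hN.eq_zero_iff k).1 h0] with t ht
      rw [ht, zero_mul]
    rw [lintegral_congr_ae hae]
    simp
  · obtain ⟨c, hc⟩ : ∃ c : ℝ≥0, (c : ℝ≥0∞) = N k := ⟨_, ENNReal.coe_toNNReal hkt⟩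
    have hc0 : c ≠ 0 := by
      rintro rfl
      exact h0 (by simpa using hc.symm)
    have hinv : ((c⁻¹ : ℝ≥0) : ℝ≥0∞) * c = 1 := by
      rw [← ENNReal.coe_mul, inv_mul_cancel₀ hc0, ENNReal.coe_one]
    have hle : ∫⁻ t in Ioo (0 : ℝ) 1, (((c⁻¹ : ℝ≥0) : ℝ≥0∞) * k t) * f t ≤ assocNorm N f :=
      le_iSup_of_le (fun t => ((c⁻¹ : ℝ≥0) : ℝ≥0∞) * k t)
        (le_iSup_of_le (hk.const_mul _)
          (le_iSup_of_le (by rw [hN.smul, ← hc, hinv]) le_rfl))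
    simp_rw [mul_assoc] at hle
    rw [lintegral_const_mul' _ _ ENNReal.coe_ne_top] at hle
    calc ∫⁻ t in Ioo (0 : ℝ) 1, k t * f t
        = c * (((c⁻¹ : ℝ≥0) : ℝ≥0∞) * ∫⁻ t in Ioo (0 : ℝ) 1, k t * f t) := by
          rw [← mul_assoc, mul_comm (c : ℝ≥0∞), hinv, one_mul]
      _ ≤ N k * assocNorm N f := by rw [← hc]; gcongr

instance isProbabilityMeasure_vol01 : IsProbabilityMeasure vol01 :=
  ⟨by simp [vol01]⟩

theorem vol01_Iic {v : ℝ} (hv1 : v < 1) : vol01 (Iic v) = ENNReal.ofReal v := by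
  have : Iic v ∩ Ioo 0 1 = Ioc 0 v := by
    ext x
    simp only [mem_inter_iff, mem_Iic, mem_Ioo, mem_Ioc]
    constructor
    · rintro ⟨h1, h2, h3⟩; exact ⟨h2, h1⟩
    · rintro ⟨h1, h2⟩; exact ⟨h2, h1, by linarith⟩
  rw [vol01, Measure.restrict_apply measurableSet_Iic, this, Real.volume_Ioc, sub_zero]

theorem continuous_cdf (ν : Measure ℝ) [IsProbabilityMeasure ν] [NullSingletonClass ν] :
    Continuous (ProbabilityTheory.cdf ν) := by
  rw [continuous_iff_continuousAt]
  intro x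
  rw [(ProbabilityTheory.monotone_cdf ν).continuousAt_iff_leftLim_eq_rightLim,
    StieltjesFunction.rightLim_eq]
  have h := StieltjesFunction.measure_singleton (ProbabilityTheory.cdf ν) x
  rw [ProbabilityTheory.measure_cdf, measure_singleton] at h
  have h1 := ENNReal.ofReal_eq_zero.1 h.symm
  have h2 := (ProbabilityTheory.monotone_cdf ν).leftLim_le (le_refl x)
  linarith

/-- The probability integral transform. -/
theorem measurePreserving_cdf (ν : Measure ℝ) [IsProbabilityMeasure ν] [NullSingletonClass ν] :
    MeasurePreserving (ProbabilityTheory.cdf ν) ν vol01 := by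
  have hmeas : Measurable (ProbabilityTheory.cdf ν) := (continuous_cdf ν).measurable
  have hIVT : ∀ v : ℝ, 0 < v → v < 1 → ∃ x, ProbabilityTheory.cdf ν x = v := by
    intro v hv0 hv1
    obtain ⟨a, ha⟩ := ((ProbabilityTheory.tendsto_cdf_atBot ν).eventually_le_const hv0).exists
    obtain ⟨b, hb⟩ := ((ProbabilityTheory.tendsto_cdf_atTop ν).eventually_const_le hv1).exists
    exact mem_range_of_exists_le_of_exists_ge (continuous_cdf ν) ⟨a, ha⟩ ⟨b, hb⟩
  refine ⟨hmeas, ?_⟩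
  have := Measure.isProbabilityMeasure_map (μ := ν) hmeas.aemeasurable
  refine Measure.ext_of_Iic _ _ fun v => ?_
  rw [Measure.map_apply hmeas measurableSet_Iic]
  rcases lt_or_ge v 0 with hv | hv0
  · have h1 : ProbabilityTheory.cdf ν ⁻¹' Iic v = ∅ := by
      ext x
      simp only [mem_preimage, mem_Iic, mem_empty_iff_false, iff_false, not_le]
      exact hv.trans_le (ProbabilityTheory.cdf_nonneg ν x)
    have h2 : Iic v ∩ Ioo 0 1 = ∅ := by
      ext x
      simp only [mem_inter_iff, mem_Iic, mem_Ioo, mem_empty_iff_false, iff_false]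
      rintro ⟨h, h', -⟩
      linarith
    rw [h1, vol01, Measure.restrict_apply measurableSet_Iic, h2]
    simp
  rcases le_or_gt 1 v with hv | hv1
  · have h1 : ProbabilityTheory.cdf ν ⁻¹' Iic v = univ := by
      ext x
      simpa using (ProbabilityTheory.cdf_le_one ν x).trans hv
    have h2 : Iic v ∩ Ioo 0 1 = Ioo 0 1 :=
      inter_eq_right.2 fun x hx => hx.2.le.trans hv
    rw [h1, vol01, Measure.restrict_apply measurableSet_Iic, h2]
    simp
  rw [vol01_Iic hv1]
  apply le_antisymm
  · refine le_of_forall_gt_imp_ge_of_dense fun y hy => ?_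
    rcases le_or_gt 1 y with h1y | hy1
    · exact prob_le_one.trans h1y
    lift y to ℝ≥0 using (hy1.trans ENNReal.one_lt_top).ne
    rw [ENNReal.ofReal_lt_iff_lt_toReal hv0 ENNReal.coe_ne_top, ENNReal.coe_toReal] at hy
    obtain ⟨x, hx⟩ := hIVT y (hv0.trans_lt hy) (by exact_mod_cast hy1)
    calc ν (ProbabilityTheory.cdf ν ⁻¹' Iic v) ≤ ν (Iic x) := by
          refine measure_mono fun z hz => ?_
          by_contra hzx
          have := ProbabilityTheory.monotone_cdf ν (not_le.1 hzx).le
          rw [hx] at this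
          exact absurd (this.trans hz) (not_le.2 hy)
      _ = y := by rw [← ProbabilityTheory.ofReal_cdf, hx, ENNReal.ofReal_coe_nnreal]
  · rcases hv0.eq_or_lt with rfl | hv0
    · simp
    obtain ⟨x, hx⟩ := hIVT v hv0 hv1
    rw [← hx, ProbabilityTheory.ofReal_cdf]
    exact measure_mono fun z hz => ProbabilityTheory.monotone_cdf ν hz

/-- Adding a suitable small multiple of the identity removes all atoms of the distribution. -/
theorem exists_noAtoms_add_mul {u : ℝ → ℝ} (hu : Measurable u) (μ : Measure ℝ)
    [IsFiniteMeasure μ] [NullSingletonClass μ] {δ : ℝ} (hδ : 0 < δ) :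
    ∃ ε ∈ Ioo 0 δ, ∀ c, μ {t | u t + ε * t = c} = 0 := by
  by_contra! hcon
  choose! c hc using hcon
  have hdisj : Pairwise (fun i j : Ioo (0 : ℝ) δ => AEDisjoint μ
      {t | u t + (i : ℝ) * t = c i} {t | u t + (j : ℝ) * t = c j}) := by
    intro i j hij
    have hij' : (i : ℝ) - j ≠ 0 := sub_ne_zero.2 fun h => hij (Subtype.ext h)
    refine measure_mono_null (t := {(c i - c j) / ((i : ℝ) - j)}) ?_ (measure_singleton _)
    rintro t ⟨h1, h2⟩
    simp only [mem_ofPred_eq] at h1 h2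
    rw [mem_singleton_iff, eq_div_iff hij', ← h1, ← h2]
    ring
  have hcount := Measure.countable_meas_pos_of_disjoint_iUnion₀ (μ := μ)
    (As := fun i : Ioo (0 : ℝ) δ => {t | u t + (i : ℝ) * t = c i})
    (fun i => (measurableSet_eq_fun (by fun_prop) measurable_const).nullMeasurableSet) hdisj
  have huniv : {i : Ioo (0 : ℝ) δ | 0 < μ {t | u t + (i : ℝ) * t = c i}} = univ := by
    ext i
    simpa using pos_iff_ne_zero.2 (hc i i.2)
  rw [huniv, countable_univ_iff] at hcount
  have : ¬ (Ioo (0 : ℝ) δ).Countable := by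
    rw [← Cardinal.le_aleph0_iff_set_countable, Cardinal.mk_Ioo_real hδ, not_le]
    exact Cardinal.aleph0_lt_continuum
  exact this (countable_coe_iff.1 hcount)

theorem decRearr_comp {σ : ℝ → ℝ} (hσ : MeasurePreserving σ vol01 vol01) {h : ℝ → ℝ≥0∞}
    (hh : Measurable h) : decRearr (fun t => h (σ t)) = decRearr h := by
  funext s
  have : ∀ ρ, vol01 {t | ρ < h (σ t)} = vol01 {t | ρ < h t} := fun ρ =>
    hσ.measure_preimage (measurableSet_lt measurable_const hh).nullMeasurableSet
  simp only [decRearr, this]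

theorem antitone_decRearr (f : ℝ → ℝ≥0∞) : Antitone (decRearr f) := fun _ _ hab =>
  sInf_le_sInf fun _ hρ => le_trans hρ (ENNReal.ofReal_le_ofReal hab)

/-- Up to an arbitrarily small error, `f` dominates its rearrangement along a
measure-preserving map. -/
theorem exists_measurePreserving_decRearr_le {f : ℝ → ℝ≥0∞} (hf : Measurable f)
    (hfin : ∀ᵐ t ∂vol01, f t ≠ ⊤) {δ : ℝ} (hδ : 0 < δ) :
    ∃ σ : ℝ → ℝ, MeasurePreserving σ vol01 vol01 ∧
      ∀ᵐ t ∂vol01, decRearr f (σ t) ≤ f t + ENNReal.ofReal δ := by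
  have hna : NullSingletonClass vol01 := by unfold vol01; infer_instance
  obtain ⟨ε, ⟨hε0, hεδ⟩, hε⟩ := exists_noAtoms_add_mul hf.ennreal_toReal vol01 hδ
  set g : ℝ → ℝ := fun t => -((f t).toReal + ε * t) with hg
  have hgm : Measurable g := by have := hf.ennreal_toReal; fun_prop
  have hmp : MeasurePreserving g vol01 (vol01.map g) := hgm.measurePreserving _
  have := Measure.isProbabilityMeasure_map (μ := vol01) hgm.aemeasurable
  have : NullSingletonClass (vol01.map g) := ⟨fun c => by
    rw [Measure.map_apply hgm (measurableSet_singleton c), ← hε (-c)]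
    congr 1
    ext t
    simp [hg, neg_eq_iff_eq_neg, -neg_add_rev]⟩
  refine ⟨_, (measurePreserving_cdf (vol01.map g)).comp hmp, ?_⟩
  have hIoo : ∀ᵐ t ∂vol01, t ∈ Ioo (0 : ℝ) 1 := ae_restrict_mem measurableSet_Ioo
  filter_upwards [hfin, hIoo] with t ht ht01
  have key : decRearr f (ProbabilityTheory.cdf (vol01.map g) (g t))
      ≤ ENNReal.ofReal ((f t).toReal + ε * t) := by
    refine sInf_le ?_
    simp only [mem_ofPred_eq]
    rw [ProbabilityTheory.ofReal_cdf, Measure.map_apply hgm measurableSet_Iic]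
    refine measure_mono_ae ?_
    filter_upwards [hfin, hIoo] with s hs hs01 hlt
    change ENNReal.ofReal _ < f s at hlt
    change g s ≤ g t
    rw [ENNReal.ofReal_lt_iff_lt_toReal (by have := ht01.1; positivity) hs] at hlt
    have : 0 < ε * s := mul_pos hε0 hs01.1
    simp only [hg]
    linarith
  refine key.trans ?_
  rw [ENNReal.ofReal_add ENNReal.toReal_nonneg (mul_nonneg hε0.le ht01.1.le),
    ENNReal.ofReal_toReal ht]
  gcongr
  nlinarith [ht01.2]

theorem IsRINorm.lintegral_decRearr_mul_le {N : (ℝ → ℝ≥0∞) → ℝ≥0∞} (hN : IsRINorm N)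
    {f h : ℝ → ℝ≥0∞} (hf : Measurable f) (hh : Measurable h) (hht : N h ≠ ⊤) :
    ∫⁻ t in Ioo (0 : ℝ) 1, decRearr f t * h t ≤ N h * assocNorm N f := by
  by_cases hfin : ∀ᵐ t ∂vol01, f t ≠ ⊤
  · obtain ⟨B, hB⟩ := hN.exists_integral_le (Ioo 0 1) measurableSet_Ioo le_rfl
    have hδ : ∀ δ : ℝ≥0, 0 < δ → ∫⁻ t in Ioo (0 : ℝ) 1, decRearr f t * h t ≤
        N h * assocNorm N f + δ * (B * N h) := by
      intro δ hδ
      obtain ⟨σ, hσ, hle⟩ := exists_measurePreserving_decRearr_le hf hfin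
        (δ := (δ : ℝ)) (by exact_mod_cast hδ)
      have hNk : N (fun t => h (σ t)) = N h := hN.rearr_invariant _ _ (decRearr_comp hσ hh)
      have hkm : Measurable (fun t => h (σ t)) := hh.comp hσ.measurable
      have hkm' : Measurable (fun t => decRearr f t * h t) :=
        (antitone_decRearr f).measurable.mul hh
      have h1 := hN.lintegral_mul_le hkm (by rwa [hNk]) f
      have h2 := hB (fun t => h (σ t))
      rw [hNk] at h1 h2
      calc ∫⁻ t in Ioo (0 : ℝ) 1, decRearr f t * h t
          = ∫⁻ t, decRearr f (σ t) * h (σ t) ∂vol01 := (hσ.lintegral_comp hkm').symm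
        _ ≤ ∫⁻ t, (h (σ t) * f t + δ * h (σ t)) ∂vol01 := by
            refine lintegral_mono_ae ?_
            filter_upwards [hle] with t ht
            rw [ENNReal.ofReal_coe_nnreal] at ht
            calc decRearr f (σ t) * h (σ t) ≤ (f t + δ) * h (σ t) := by gcongr
              _ = _ := by ring
        _ = (∫⁻ t in Ioo (0 : ℝ) 1, h (σ t) * f t)
              + δ * ∫⁻ t in Ioo (0 : ℝ) 1, h (σ t) := by
            rw [lintegral_add_right _ (hkm.const_mul _), lintegral_const_mul _ hkm, vol01]
        _ ≤ _ := by gcongr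
    have hlim : Filter.Tendsto (fun δ : ℝ≥0 => N h * assocNorm N f + δ * (B * N h))
        (nhdsWithin 0 (Ioi 0)) (nhds (N h * assocNorm N f)) := by
      have hc : Filter.Tendsto (fun δ : ℝ≥0 => (δ : ℝ≥0∞) * (B * N h)) (nhds 0) (nhds 0) := by
        have := ENNReal.Tendsto.mul_const (b := (B : ℝ≥0∞) * N h)
          (ENNReal.tendsto_coe.2 (Filter.tendsto_id (x := nhds (0 : ℝ≥0))))
          (Or.inr (ENNReal.mul_ne_top ENNReal.coe_ne_top hht))
        simpa using this
      simpa using (tendsto_const_nhds.add hc).mono_left nhdsWithin_le_nhds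
    refine ge_of_tendsto hlim ?_
    filter_upwards [self_mem_nhdsWithin] with δ hpos using hδ δ hpos
  · rcases eq_or_ne (N h) 0 with h0 | h0
    · have hae : ∀ᵐ t ∂(volume.restrict (Ioo (0 : ℝ) 1)), decRearr f t * h t = 0 := by
        filter_upwards [(hN.eq_zero_iff h).1 h0] with t ht
        rw [ht, mul_zero]
      rw [lintegral_congr_ae hae]
      simp
    · have hEm : MeasurableSet (Ioo (0 : ℝ) 1) := measurableSet_Ioo
      have hle := hN.lintegral_mul_le (k := (Ioo (0 : ℝ) 1).indicator 1)
        (measurable_one.indicator hEm) (hN.indicator_lt_top _ hEm le_rfl).ne f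
      have htop : ∫⁻ t in Ioo (0 : ℝ) 1, (Ioo (0 : ℝ) 1).indicator 1 t * f t = ⊤ := by
        have : ∫⁻ t in Ioo (0 : ℝ) 1, (Ioo (0 : ℝ) 1).indicator 1 t * f t
            = ∫⁻ t in Ioo (0 : ℝ) 1, f t :=
          setLIntegral_congr_fun hEm fun t ht => by simp [indicator_of_mem ht]
        rw [this]
        by_contra hne
        exact hfin ((ae_lt_top hf hne).mono fun t ht => ht.ne)
      rw [htop, top_le_iff] at hle
      have hA : assocNorm N f = ⊤ := by
        by_contra hA
        exact ENNReal.mul_ne_top (hN.indicator_lt_top _ hEm le_rfl).ne hA hle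
      rw [hA, ENNReal.mul_top h0]
      exact le_top

theorem measurable_S1 (n m : ℕ) (d : ℝ) {f : ℝ → ℝ≥0∞} (hf : Measurable f) :
    Measurable (S1 n m d f) := by
  have hset : MeasurableSet {p : ℝ × ℝ | p.1 ^ ((n : ℝ) / d) < p.2 ∧ p.2 < 1} :=
    (measurableSet_lt (by fun_prop) measurable_snd).inter
      (measurableSet_lt measurable_snd measurable_const)
  have h := Measurable.lintegral_prod_right' (ν := (volume : Measure ℝ))
    (f := {p : ℝ × ℝ | p.1 ^ ((n : ℝ) / d) < p.2 ∧ p.2 < 1}.indicator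
      fun p => ENNReal.ofReal (p.2 ^ ((m : ℝ) / n - 1)) * f p.2)
    (Measurable.indicator (by fun_prop) hset)
  convert h using 2 with t
  rw [S1, ← lintegral_indicator measurableSet_Ioo]
  rfl

/-- The operator `S1` is dual to `f ↦ t^{m/n-1} ∫_0^{t^{d/n}} f`. -/
theorem lintegral_mul_S1 (n m : ℕ) (hn : 0 < n) {d : ℝ} (hd : 0 < d) {f F : ℝ → ℝ≥0∞}
    (hf : Measurable f) (hF : Measurable F) :
    ∫⁻ t in Ioo (0 : ℝ) 1, f t * (ENNReal.ofReal (t ^ ((m : ℝ) / n - 1)) *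
      ∫⁻ s in Ioo (0 : ℝ) (t ^ (d / (n : ℝ))), F s) =
    ∫⁻ s in Ioo (0 : ℝ) 1, F s * S1 n m d f s := by
  have hn' : (0 : ℝ) < n := by exact_mod_cast hn
  set w : ℝ → ℝ≥0∞ := fun t => ENNReal.ofReal (t ^ ((m : ℝ) / n - 1)) * f t with hw
  have hwm : Measurable w := by fun_prop
  set D : Set (ℝ × ℝ) := {p | p.2 < p.1 ^ (d / (n : ℝ))} with hD
  have hDm : MeasurableSet D := measurableSet_lt measurable_snd (by fun_prop)
  have hiff : ∀ s t : ℝ, 0 < s → 0 < t → (s < t ^ (d / (n : ℝ)) ↔ s ^ ((n : ℝ) / d) < t) := by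
    intro s t hs ht
    rw [← Real.lt_rpow_inv_iff_of_pos hs.le ht.le (by positivity), inv_div]
  calc _ = ∫⁻ t in Ioo (0 : ℝ) 1, ∫⁻ s in Ioo (0 : ℝ) 1,
        D.indicator (fun p => w p.1 * F p.2) (t, s) := by
        refine setLIntegral_congr_fun measurableSet_Ioo fun t ht => ?_
        have hsub : ∀ s, (Ioo (0 : ℝ) 1).indicator
            (fun s => D.indicator (fun p => w p.1 * F p.2) (t, s)) s =
            (Ioo (0 : ℝ) (t ^ (d / (n : ℝ)))).indicator (fun s => w t * F s) s := by
          intro s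
          have h1 : t ^ (d / (n : ℝ)) < 1 := Real.rpow_lt_one ht.1.le ht.2 (by positivity)
          by_cases hs : s ∈ Ioo (0 : ℝ) (t ^ (d / (n : ℝ)))
          · rw [indicator_of_mem hs,
              indicator_of_mem (show s ∈ Ioo (0 : ℝ) 1 from ⟨hs.1, hs.2.trans h1⟩),
              indicator_of_mem (show (t, s) ∈ D from hs.2)]
          · rw [indicator_of_notMem hs]
            by_cases hs1 : s ∈ Ioo (0 : ℝ) 1
            · rw [indicator_of_mem hs1,
                indicator_of_notMem (show (t, s) ∉ D from fun h => hs ⟨hs1.1, h⟩)]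
            · rw [indicator_of_notMem hs1]
        rw [← lintegral_indicator measurableSet_Ioo (fun s => D.indicator _ (t, s)),
          lintegral_congr hsub, lintegral_indicator measurableSet_Ioo,
          lintegral_const_mul _ hF, hw]
        ring
    _ = ∫⁻ s in Ioo (0 : ℝ) 1, ∫⁻ t in Ioo (0 : ℝ) 1,
        D.indicator (fun p => w p.1 * F p.2) (t, s) :=
        lintegral_lintegral_swap
          (Measurable.aemeasurable (Measurable.indicator (by fun_prop) hDm))
    _ = _ := by
        refine setLIntegral_congr_fun measurableSet_Ioo fun s hs => ?_
        have hsub : ∀ t, (Ioo (0 : ℝ) 1).indicator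
            (fun t => D.indicator (fun p => w p.1 * F p.2) (t, s)) t =
            (Ioo (s ^ ((n : ℝ) / d)) 1).indicator (fun t => F s * w t) t := by
          intro t
          have h0 : 0 < s ^ ((n : ℝ) / d) := Real.rpow_pos_of_pos hs.1 _
          by_cases ht : t ∈ Ioo (s ^ ((n : ℝ) / d)) 1
          · have ht0 : 0 < t := h0.trans ht.1
            rw [indicator_of_mem ht, indicator_of_mem (show t ∈ Ioo (0 : ℝ) 1 from ⟨ht0, ht.2⟩),
              indicator_of_mem (show (t, s) ∈ D from (hiff s t hs.1 ht0).2 ht.1), mul_comm]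
          · rw [indicator_of_notMem ht]
            by_cases ht1 : t ∈ Ioo (0 : ℝ) 1
            · rw [indicator_of_mem ht1, indicator_of_notMem
                (show (t, s) ∉ D from fun h => ht ⟨(hiff s t hs.1 ht1.1).1 h, ht1.2⟩)]
            · rw [indicator_of_notMem ht1]
        rw [← lintegral_indicator measurableSet_Ioo (fun t => D.indicator _ (t, s)),
          lintegral_congr hsub, lintegral_indicator measurableSet_Ioo,
          lintegral_const_mul _ hwm, S1]

/-- **Duality step identifying the optimal target norm:** if `S₁ : X → Z` with norm `≤ C`,
then the dual operator `f ↦ t^{-1+m/n} ∫_0^{t^{d/n}} f*(s) ds` maps `Z'` to `X'` with the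
same norm. -/
theorem optimal_target_duality (n m : ℕ) (hn : 2 ≤ n) (hm : 1 ≤ m) (hmn : m < n)
    (d : ℝ) (hd0 : 0 < d) (hdn : d ≤ n)
    (NX NZ : (ℝ → ℝ≥0∞) → ℝ≥0∞) (hX : IsRINorm NX) (hZ : IsRINorm NZ)
    (C : ℝ) (hC : 0 ≤ C)
    (hS1 : ∀ f : ℝ → ℝ≥0∞, Measurable f →
        NZ (S1 n m d f) ≤ ENNReal.ofReal C * NX f) :
    ∀ f : ℝ → ℝ≥0∞, Measurable f →
      assocNorm NX (fun t => ENNReal.ofReal (t ^ ((m : ℝ) / n - 1)) *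
          ∫⁻ s in Set.Ioo (0 : ℝ) (t ^ (d / (n : ℝ))), decRearr f s) ≤
        ENNReal.ofReal C * assocNorm NZ f := by
  intro f hf
  refine iSup_le fun φ => iSup_le fun hφ => iSup_le fun hφ1 => ?_
  have hle : NZ (S1 n m d φ) ≤ ENNReal.ofReal C :=
    (hS1 φ hφ).trans (mul_le_of_le_one_right' hφ1)
  rw [lintegral_mul_S1 n m (by omega) hd0 hφ (antitone_decRearr f).measurable]
  exact (hZ.lintegral_decRearr_mul_le hf (measurable_S1 n m d hφ)
    (hle.trans_lt ENNReal.ofReal_lt_top).ne).trans (by gcongr)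
end

section
/- Let Ω be an open set of finite Lebesgue measure in ℝⁿ, n ≥ 2, let m ∈ ℕ with m < n, and let d ∈ (0, n−m). Let ‖·‖_X and ‖·‖_Y be rearrangement-invariant function norms on (0,1), and let μ be a finite Borel measure on Ω with sup_{x ∈ ℝⁿ, r > 0} μ(B_r(x) ∩ Ω)/r^d < ∞. Assume there is a constant C₁ such that, for every nonnegative non-increasing measurable f on (0,1), both ‖ t ↦ ∫_{t^{n/d}}^1 f(s) s^{−1+m/n} ds ‖_Y ≤ C₁ ‖f‖_X and ‖ t ↦ t^{−m/(n−d)} ∫₀^{t^{n/d}} f(s) s^{−1+m/(n−d)} ds ‖_Y ≤ C₁ ‖f‖_X. Then there exists a constant C₂ such that for every u ∈ C_c^∞(Ω): ‖ t ↦ ( (1/t) ∫₀^t u*_μ(μ(Ω)·s)^{(n−d)/m} ds )^{m/(n−d)} ‖_Y ≤ C₂ ‖ t ↦ (|∇^m u|)*(|Ω|·t) ‖_X. In particular, ‖ t ↦ u*_μ(μ(Ω)·t) ‖_Y ≤ C₂ ‖ t ↦ (|∇^m u|)*(|Ω|·t) ‖_X. -/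
open MeasureTheory Set
open scoped ENNReal NNReal

lemma lintegral_Ioo_rpow {r R β : ℝ} (hr : 0 ≤ r) (hrR : r ≤ R) (h : 0 < r ∨ 0 < β)
    (hβ : β ≠ 0) :
    ∫⁻ s in Ioo r R, ENNReal.ofReal (s ^ (β - 1)) = ENNReal.ofReal ((R ^ β - r ^ β) / β) := by
  have hint : IntervalIntegrable (fun s : ℝ => s ^ (β - 1)) volume r R := by
    rcases h with h | h
    · refine intervalIntegral.intervalIntegrable_rpow (Or.inr ?_)
      rw [uIcc_of_le hrR]
      exact fun h0 => absurd h0.1 (not_le.2 h)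
    · exact intervalIntegral.intervalIntegrable_rpow' (by linarith)
  rw [← ofReal_integral_eq_lintegral_ofReal]
  · rw [← integral_Ioc_eq_integral_Ioo, ← intervalIntegral.integral_of_le hrR, integral_rpow]
    · simp
    · rcases h with h | h
      · right
        refine ⟨fun h0 => hβ (by linarith), ?_⟩
        rw [uIcc_of_le hrR]
        exact fun h0 => absurd h0.1 (not_le.2 h)
      · left; linarith
  · exact ((intervalIntegrable_iff_integrableOn_Ioo_of_le hrR).1 hint)
  · filter_upwards [ae_restrict_mem measurableSet_Ioo] with s hs
    exact Real.rpow_nonneg (hr.trans hs.1.le) _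

lemma lintegral_Ioi_rpow {R ε : ℝ} (hR : 0 < R) (hε : 0 < ε) :
    ∫⁻ s in Ioi R, ENNReal.ofReal (s ^ (-ε - 1)) = ENNReal.ofReal (R ^ (-ε) / ε) := by
  rw [← ofReal_integral_eq_lintegral_ofReal]
  · rw [integral_Ioi_rpow_of_lt (by linarith) hR]
    congr 1
    rw [show -ε - 1 + 1 = -ε by ring]
    field_simp
  · exact integrableOn_Ioi_rpow_of_lt (by linarith) hR
  · filter_upwards [ae_restrict_mem measurableSet_Ioi] with s hs
    exact Real.rpow_nonneg (hR.le.trans (mem_Ioi.1 hs).le) _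

/-- Distribution-function formula for the integral of an extended-nonnegative function. -/
lemma lintegral_eq_lintegral_meas_ofReal_lt {α : Type*} [MeasurableSpace α] (ν : Measure α)
    [SFinite ν] {φ : α → ℝ≥0∞} (hφ : Measurable φ) :
    ∫⁻ x, φ x ∂ν = ∫⁻ σ in Ioi (0 : ℝ), ν {x | ENNReal.ofReal σ < φ x} := by
  have key : ∀ x, φ x = ∫⁻ σ in Ioi (0 : ℝ),
      {p : α × ℝ | ENNReal.ofReal p.2 < φ p.1}.indicator 1 (x, σ) := by
    intro x
    have : ∀ σ : ℝ, {p : α × ℝ | ENNReal.ofReal p.2 < φ p.1}.indicator (1 : α × ℝ → ℝ≥0∞) (x, σ)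
        = {σ : ℝ | ENNReal.ofReal σ < φ x}.indicator 1 σ := fun σ => rfl
    simp_rw [this]
    rw [lintegral_indicator_one (measurableSet_lt ENNReal.measurable_ofReal measurable_const),
      Measure.restrict_apply (measurableSet_lt ENNReal.measurable_ofReal measurable_const)]
    rcases eq_or_ne (φ x) ⊤ with h | h
    · rw [h]
      simp
    · have : {σ : ℝ | ENNReal.ofReal σ < φ x} ∩ Ioi 0 = Ioo 0 (φ x).toReal := by
        ext σ
        simp only [mem_inter_iff, mem_ofPred_eq, mem_Ioi, mem_Ioo]
        constructor
        · rintro ⟨h1, h2⟩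
          exact ⟨h2, (ENNReal.ofReal_lt_iff_lt_toReal h2.le h).1 h1⟩
        · rintro ⟨h1, h2⟩
          exact ⟨(ENNReal.ofReal_lt_iff_lt_toReal h1.le h).2 h2, h1⟩
      rw [this, Real.volume_Ioo, sub_zero, ENNReal.ofReal_toReal h]
  have hms : MeasurableSet {p : α × ℝ | ENNReal.ofReal p.2 < φ p.1} :=
    measurableSet_lt (ENNReal.measurable_ofReal.comp measurable_snd) (hφ.comp measurable_fst)
  conv_lhs => enter [2, x]; rw [key x]
  rw [lintegral_lintegral_swap (f := fun x σ =>
    {p : α × ℝ | ENNReal.ofReal p.2 < φ p.1}.indicator 1 (x, σ))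
    ((measurable_one.indicator hms).aemeasurable)]
  refine lintegral_congr fun σ => ?_
  have : ∀ x : α, {p : α × ℝ | ENNReal.ofReal p.2 < φ p.1}.indicator (1 : α × ℝ → ℝ≥0∞) (x, σ)
        = {x : α | ENNReal.ofReal σ < φ x}.indicator 1 x := fun σ => rfl
  simp_rw [this]
  rw [lintegral_indicator_one (measurableSet_lt measurable_const hφ)]

/-- Integrals of `dist x y ^ (-γ)` over balls, for a measure of upper dimension `δ > γ`. -/
lemma lintegral_ball_dist_rpow_le {X : Type*} [PseudoMetricSpace X] [MeasurableSpace X]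
    [OpensMeasurableSpace X] (ν : Measure X) [SFinite ν] (x : X) {A γ δ R : ℝ}
    (hA : 0 ≤ A) (hν : ∀ r : ℝ, 0 < r → ν (Metric.ball x r) ≤ ENNReal.ofReal (A * r ^ δ))
    (hγ : 0 < γ) (hγδ : γ < δ) (hR : 0 < R) :
    ∫⁻ y in Metric.ball x R, ENNReal.ofReal (dist y x ^ (-γ)) ∂ν ≤
      ENNReal.ofReal (A * (1 + γ / (δ - γ)) * R ^ (δ - γ)) := by
  have hδ : 0 < δ - γ := by linarith
  have hd : Measurable fun y => dist y x := (continuous_id.dist continuous_const).measurable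
  let F : X × ℝ → ℝ≥0∞ := {p : X × ℝ | dist p.1 x < p.2}.indicator
    fun p => ENNReal.ofReal (γ * p.2 ^ (-γ - 1))
  have hF : Measurable F := by
    refine Measurable.indicator (by fun_prop) (measurableSet_lt (hd.comp measurable_fst)
      measurable_snd)
  have key : ∀ y ∈ Metric.ball x R, ENNReal.ofReal (dist y x ^ (-γ)) ≤
      ENNReal.ofReal (R ^ (-γ)) + ∫⁻ s in Ioo 0 R, F (y, s) := by
    intro y hy
    rcases (dist_nonneg (x := y) (y := x)).eq_or_lt with h0 | h0
    · rw [← h0, Real.zero_rpow (by linarith)]; simp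
    · have h1 : ∫⁻ s in Ioo (dist y x) R, ENNReal.ofReal γ * ENNReal.ofReal (s ^ (-γ - 1)) ≤
          ∫⁻ s in Ioo 0 R, F (y, s) := by
        rw [← lintegral_indicator measurableSet_Ioo, ← lintegral_indicator measurableSet_Ioo]
        refine lintegral_mono fun s => ?_
        refine indicator_apply_le' (fun hs => ?_) (fun _ => bot_le)
        rw [indicator_of_mem (show s ∈ Ioo 0 R from ⟨h0.trans hs.1, hs.2⟩)]
        simp only [F]
        rw [indicator_of_mem (show (y, s) ∈ {p : X × ℝ | dist p.1 x < p.2} from hs.1),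
          ENNReal.ofReal_mul hγ.le]
      refine le_trans ?_ (add_le_add_right h1 _)
      rw [lintegral_const_mul _ (by fun_prop), lintegral_Ioo_rpow h0.le (Metric.mem_ball.1 hy).le
        (Or.inl h0) (by linarith), ← ENNReal.ofReal_mul hγ.le, ← ENNReal.ofReal_add
        (Real.rpow_nonneg hR.le _)]
      · refine ENNReal.ofReal_le_ofReal (le_of_eq ?_)
        field_simp
        ring
      · have : R ^ (-γ) ≤ dist y x ^ (-γ) :=
          Real.rpow_le_rpow_of_nonpos h0 (Metric.mem_ball.1 hy).le (by linarith)
        refine mul_nonneg hγ.le (div_nonneg_of_nonpos (by linarith) (by linarith))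
  calc ∫⁻ y in Metric.ball x R, ENNReal.ofReal (dist y x ^ (-γ)) ∂ν
      ≤ ∫⁻ y in Metric.ball x R, (ENNReal.ofReal (R ^ (-γ)) + ∫⁻ s in Ioo 0 R, F (y, s)) ∂ν :=
        setLIntegral_mono' measurableSet_ball key
    _ = ENNReal.ofReal (R ^ (-γ)) * ν (Metric.ball x R) +
        ∫⁻ s in Ioo 0 R, ∫⁻ y in Metric.ball x R, F (y, s) ∂ν := by
        rw [lintegral_add_left measurable_const, setLIntegral_const, lintegral_lintegral_swap]
        exact hF.aemeasurable
    _ ≤ ENNReal.ofReal (R ^ (-γ)) * ENNReal.ofReal (A * R ^ δ) +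
        ∫⁻ s in Ioo 0 R, ENNReal.ofReal (γ * A) * ENNReal.ofReal (s ^ (δ - γ - 1)) := by
        refine add_le_add ?_ ?_
        · gcongr
          exact hν R hR
        · refine setLIntegral_mono' measurableSet_Ioo fun s hs => ?_
          calc ∫⁻ y in Metric.ball x R, F (y, s) ∂ν ≤ ∫⁻ y, F (y, s) ∂ν := setLIntegral_le_lintegral _ _
            _ = ∫⁻ y, (Metric.ball x s).indicator
                  (fun _ => ENNReal.ofReal (γ * s ^ (-γ - 1))) y ∂ν := rfl
            _ = ENNReal.ofReal (γ * s ^ (-γ - 1)) * ν (Metric.ball x s) := by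
                rw [lintegral_indicator measurableSet_ball, setLIntegral_const]
            _ ≤ ENNReal.ofReal (γ * s ^ (-γ - 1)) * ENNReal.ofReal (A * s ^ δ) := by
                gcongr; exact hν s hs.1
            _ = _ := by
                have := Real.rpow_nonneg hs.1.le (-γ - 1)
                rw [← ENNReal.ofReal_mul (by positivity), ← ENNReal.ofReal_mul (by positivity),
                  show δ - γ - 1 = (-γ - 1) + δ by ring, Real.rpow_add hs.1]
                ring_nf
    _ = _ := by
        have h1 := Real.rpow_nonneg hR.le (-γ)
        have h2 := Real.rpow_nonneg hR.le (δ)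
        have h3 := Real.rpow_nonneg hR.le (δ - γ)
        rw [lintegral_const_mul _ (by fun_prop), lintegral_Ioo_rpow le_rfl hR.le (Or.inr hδ) hδ.ne',
          Real.zero_rpow hδ.ne', sub_zero, ← ENNReal.ofReal_mul h1,
          ← ENNReal.ofReal_mul (by positivity), ← ENNReal.ofReal_add (by positivity)
          (by positivity)]
        congr 1
        have : R ^ (-γ) * R ^ δ = R ^ (δ - γ) := by rw [← Real.rpow_add hR]; ring_nf
        calc _ = A * (R ^ (-γ) * R ^ δ) + γ * A * (R ^ (δ - γ) / (δ - γ)) := by ring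
          _ = _ := by rw [this]; ring

/-- Integrals of `dist x y ^ (-γ)` off balls, for a measure of upper dimension `δ < γ`. -/
lemma lintegral_compl_ball_dist_rpow_le {X : Type*} [PseudoMetricSpace X] [MeasurableSpace X]
    [OpensMeasurableSpace X] (ν : Measure X) [SFinite ν] (x : X) {A γ δ R : ℝ}
    (hA : 0 ≤ A) (hν : ∀ r : ℝ, 0 < r → ν (Metric.ball x r) ≤ ENNReal.ofReal (A * r ^ δ))
    (hγ : 0 < γ) (hγδ : δ < γ) (hR : 0 < R) :
    ∫⁻ y in (Metric.ball x R)ᶜ, ENNReal.ofReal (dist y x ^ (-γ)) ∂ν ≤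
      ENNReal.ofReal (A * γ / (γ - δ) * R ^ (-(γ - δ))) := by
  have hδ : 0 < γ - δ := by linarith
  have hd : Measurable fun y => dist y x := (continuous_id.dist continuous_const).measurable
  let F : X × ℝ → ℝ≥0∞ := {p : X × ℝ | dist p.1 x < p.2}.indicator
    fun p => ENNReal.ofReal (γ * p.2 ^ (-γ - 1))
  have hF : Measurable F := by
    refine Measurable.indicator (by fun_prop) (measurableSet_lt (hd.comp measurable_fst)
      measurable_snd)
  have key : ∀ y ∈ (Metric.ball x R)ᶜ, ENNReal.ofReal (dist y x ^ (-γ)) ≤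
      ∫⁻ s in Ioi R, F (y, s) := by
    intro y hy
    have hy' : R ≤ dist y x := not_lt.1 hy
    have h0 : 0 < dist y x := hR.trans_le hy'
    have h1 : ∫⁻ s in Ioi (dist y x), ENNReal.ofReal γ * ENNReal.ofReal (s ^ (-γ - 1)) ≤
        ∫⁻ s in Ioi R, F (y, s) := by
      rw [← lintegral_indicator measurableSet_Ioi, ← lintegral_indicator measurableSet_Ioi]
      refine lintegral_mono fun s => ?_
      refine indicator_apply_le' (fun hs => ?_) (fun _ => bot_le)
      rw [indicator_of_mem (show s ∈ Ioi R from hy'.trans_lt hs)]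
      simp only [F]
      rw [indicator_of_mem (show (y, s) ∈ {p : X × ℝ | dist p.1 x < p.2} from hs),
        ENNReal.ofReal_mul hγ.le]
    refine le_trans ?_ h1
    rw [lintegral_const_mul _ (by fun_prop), lintegral_Ioi_rpow h0 hγ, ← ENNReal.ofReal_mul hγ.le]
    refine ENNReal.ofReal_le_ofReal (le_of_eq ?_)
    field_simp
  calc ∫⁻ y in (Metric.ball x R)ᶜ, ENNReal.ofReal (dist y x ^ (-γ)) ∂ν
      ≤ ∫⁻ y in (Metric.ball x R)ᶜ, (∫⁻ s in Ioi R, F (y, s)) ∂ν :=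
        setLIntegral_mono' measurableSet_ball.compl key
    _ = ∫⁻ s in Ioi R, ∫⁻ y in (Metric.ball x R)ᶜ, F (y, s) ∂ν := by
        rw [lintegral_lintegral_swap]
        exact hF.aemeasurable
    _ ≤ ∫⁻ s in Ioi R, ENNReal.ofReal (γ * A) * ENNReal.ofReal (s ^ (-(γ - δ) - 1)) := by
        refine setLIntegral_mono' measurableSet_Ioi fun s hs => ?_
        have hs0 : 0 < s := hR.trans hs
        calc ∫⁻ y in (Metric.ball x R)ᶜ, F (y, s) ∂ν ≤ ∫⁻ y, F (y, s) ∂ν :=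
              setLIntegral_le_lintegral _ _
          _ = ∫⁻ y, (Metric.ball x s).indicator
                (fun _ => ENNReal.ofReal (γ * s ^ (-γ - 1))) y ∂ν := rfl
          _ = ENNReal.ofReal (γ * s ^ (-γ - 1)) * ν (Metric.ball x s) := by
              rw [lintegral_indicator measurableSet_ball, setLIntegral_const]
          _ ≤ ENNReal.ofReal (γ * s ^ (-γ - 1)) * ENNReal.ofReal (A * s ^ δ) := by
              gcongr; exact hν s hs0
          _ = _ := by
              have := Real.rpow_nonneg hs0.le (-γ - 1)
              rw [← ENNReal.ofReal_mul (by positivity), ← ENNReal.ofReal_mul (by positivity),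
                show -(γ - δ) - 1 = (-γ - 1) + δ by ring, Real.rpow_add hs0]
              ring_nf
    _ = _ := by
        rw [lintegral_const_mul _ (by fun_prop), lintegral_Ioi_rpow hR hδ,
          ← ENNReal.ofReal_mul (by positivity)]
        congr 1
        ring

/-- The truncated Riesz-type potential `∫_G |x - y|^{-γ} dy`. -/
noncomputable def setPotential {n : ℕ} (γ : ℝ) (G : Set (EuclideanSpace ℝ (Fin n)))
    (x : EuclideanSpace ℝ (Fin n)) : ℝ≥0∞ :=
  ∫⁻ y in G, ENNReal.ofReal (dist y x ^ (-γ))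

lemma measurable_setPotential {n : ℕ} (γ : ℝ) (G : Set (EuclideanSpace ℝ (Fin n))) :
    Measurable (setPotential γ G) := by
  have h : Measurable fun p : EuclideanSpace ℝ (Fin n) × EuclideanSpace ℝ (Fin n) =>
      ENNReal.ofReal (dist p.2 p.1 ^ (-γ)) :=
    ((measurable_snd.dist measurable_fst).pow_const _).ennreal_ofReal
  exact h.lintegral_prod_right'

lemma exists_volume_ball_le (n : ℕ) (hn : 1 ≤ n) :
    ∃ ω : ℝ, 0 < ω ∧ ∀ (x : EuclideanSpace ℝ (Fin n)) (r : ℝ), 0 < r →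
      volume (Metric.ball x r) ≤ ENNReal.ofReal (ω * r ^ (n : ℝ)) := by
  have : Nonempty (Fin n) := ⟨⟨0, hn⟩⟩
  refine ⟨(volume (Metric.ball (0 : EuclideanSpace ℝ (Fin n)) 1)).toReal,
    ENNReal.toReal_pos (Metric.measure_ball_pos _ _ one_pos).ne' measure_ball_lt_top.ne,
    fun x r hr => ?_⟩
  rw [Measure.addHaar_ball _ _ hr.le, ENNReal.ofReal_mul ENNReal.toReal_nonneg,
    ENNReal.ofReal_toReal measure_ball_lt_top.ne, finrank_euclideanSpace, Fintype.card_fin,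
    Real.rpow_natCast, mul_comm]

lemma exists_setPotential_ball_le (n : ℕ) (hn : 1 ≤ n) {γ : ℝ} (hγ : 0 < γ) (hγn : γ < n) :
    ∃ C : ℝ, 0 < C ∧ ∀ (x : EuclideanSpace ℝ (Fin n)) (R : ℝ), 0 < R →
      setPotential γ (Metric.ball x R) x ≤ ENNReal.ofReal (C * R ^ (n - γ)) := by
  obtain ⟨ω, hω, h⟩ := exists_volume_ball_le n hn
  have : 0 < (n : ℝ) - γ := by linarith
  exact ⟨ω * (1 + γ / (n - γ)), by positivity, fun x R hR =>
    lintegral_ball_dist_rpow_le volume x hω.le (h x) hγ hγn hR⟩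

/-- `‖I_a χ_G‖_∞ ≤ C |G|^{a/n}`. -/
lemma exists_setPotential_le_volume_rpow (n : ℕ) (hn : 1 ≤ n) {γ : ℝ} (hγ : 0 < γ)
    (hγn : γ < n) :
    ∃ C : ℝ, 0 < C ∧ ∀ (G : Set (EuclideanSpace ℝ (Fin n))) (x : EuclideanSpace ℝ (Fin n)),
      volume G < ⊤ → setPotential γ G x ≤ ENNReal.ofReal C * volume G ^ ((n - γ) / n) := by
  obtain ⟨C, hC, h⟩ := exists_setPotential_ball_le n hn hγ hγn
  have hn0 : (0 : ℝ) < n := by exact_mod_cast hn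
  refine ⟨C + 1, by positivity, fun G x hG => ?_⟩
  rcases eq_or_ne (volume G) 0 with h0 | h0
  · simp [setPotential, Measure.restrict_eq_zero.2 h0]
  set V := (volume G).toReal with hV
  have hV0 : 0 < V := ENNReal.toReal_pos h0 hG.ne
  have hVe : volume G = ENNReal.ofReal V := (ENNReal.ofReal_toReal hG.ne).symm
  set R := V ^ (1 / (n : ℝ)) with hR
  have hR0 : 0 < R := Real.rpow_pos_of_pos hV0 _
  have h1 : setPotential γ G x ≤ setPotential γ (Metric.ball x R) x +
      ∫⁻ y in G \ Metric.ball x R, ENNReal.ofReal (R ^ (-γ)) := by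
    calc setPotential γ G x
        ≤ ∫⁻ y in Metric.ball x R ∪ (G \ Metric.ball x R), ENNReal.ofReal (dist y x ^ (-γ)) :=
          lintegral_mono_set (by rw [union_sdiff_self]; exact subset_union_right)
      _ ≤ _ := (lintegral_union_le _ _ _).trans ?_
    refine add_le_add le_rfl ?_
    refine setLIntegral_mono measurable_const fun y hy => ENNReal.ofReal_le_ofReal ?_
    exact Real.rpow_le_rpow_of_nonpos hR0 (not_lt.1 hy.2) (by linarith)
  have hRp : R ^ (n - γ) = V ^ ((n - γ) / n) := by
    rw [hR, ← Real.rpow_mul hV0.le]; ring_nf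
  have hRq : R ^ (-γ) * V = V ^ ((n - γ) / n) := by
    rw [hR, ← Real.rpow_mul hV0.le]
    nth_rewrite 2 [← Real.rpow_one V]
    rw [← Real.rpow_add hV0]
    congr 1
    field_simp
    ring
  refine h1.trans ?_
  rw [hVe, ENNReal.ofReal_rpow_of_pos hV0, ← ENNReal.ofReal_mul (by positivity), add_mul,
    ENNReal.ofReal_add (by positivity) (by positivity)]
  refine add_le_add ((h x R hR0).trans (by rw [hRp])) ?_
  rw [setLIntegral_const, one_mul, ← hRq, ENNReal.ofReal_mul (by positivity), ← hVe]
  gcongr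
  exact sdiff_subset

lemma rpow_comparison {a γ c b B r : ℝ} (ha : 0 < a) (hγ : 0 < γ) (hc : 0 < c) (hb : 0 < b)
    (hB : 0 < B) (hr : c * b ^ (1 / a) ≤ r)
    (h1 : b ≤ 2 * (1 + r / (c * b ^ (1 / a))) ^ γ * B)
    (h2 : B ≤ 2 * (1 + r / (c * B ^ (1 / a))) ^ γ * b) :
    c * (2 * 2 ^ γ) ^ (-(1 / a)) * B ^ (1 / a) ≤ r ∧
      b ^ ((a + γ) / a) ≤ 2 * 2 ^ γ * c ^ (-γ) * r ^ γ * B := by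
  have hb1 : 0 < b ^ (1 / a) := Real.rpow_pos_of_pos hb _
  have hB1 : 0 < B ^ (1 / a) := Real.rpow_pos_of_pos hB _
  have hR : 0 < c * b ^ (1 / a) := mul_pos hc hb1
  have hr0 : 0 < r := hR.trans_le hr
  have h2γ : (1 : ℝ) ≤ 2 ^ γ := Real.one_le_rpow (by norm_num) hγ.le
  constructor
  · have hle1 : (2 * 2 ^ γ : ℝ) ^ (-(1 / a)) ≤ 1 :=
      Real.rpow_le_one_of_one_le_of_nonpos (by linarith) (by
        have : 0 < 1 / a := by positivity
        linarith)
    rcases le_or_gt (c * B ^ (1 / a)) r with h | h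
    · calc c * (2 * 2 ^ γ) ^ (-(1 / a)) * B ^ (1 / a) ≤ c * 1 * B ^ (1 / a) := by gcongr
        _ ≤ r := by rw [mul_one]; exact h
    · have h3 : B ≤ 2 * 2 ^ γ * b := by
        refine h2.trans ?_
        gcongr
        have : r / (c * B ^ (1 / a)) ≤ 1 := (div_le_one (by positivity)).2 h.le
        linarith
      calc c * (2 * 2 ^ γ) ^ (-(1 / a)) * B ^ (1 / a)
          ≤ c * (2 * 2 ^ γ) ^ (-(1 / a)) * (2 * 2 ^ γ * b) ^ (1 / a) := by gcongr
        _ = c * b ^ (1 / a) := by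
            rw [Real.mul_rpow (by positivity) hb.le, Real.rpow_neg (by positivity)]
            field_simp
        _ ≤ r := hr
  · have h3 : 1 + r / (c * b ^ (1 / a)) ≤ 2 * (r / (c * b ^ (1 / a))) := by
      have : 1 ≤ r / (c * b ^ (1 / a)) := (one_le_div hR).2 hr
      linarith
    have h4 : b ≤ 2 * (2 * (r / (c * b ^ (1 / a)))) ^ γ * B := h1.trans (by gcongr)
    rw [Real.mul_rpow (by norm_num) (by positivity), Real.div_rpow hr0.le hR.le,
      Real.mul_rpow hc.le hb1.le, ← Real.rpow_mul hb.le] at h4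
    have h5 : b ^ ((a + γ) / a) = b * b ^ (1 / a * γ) := by
      nth_rewrite 2 [← Real.rpow_one b]
      rw [← Real.rpow_add hb]
      congr 1
      field_simp
    rw [h5, Real.rpow_neg hc.le]
    have hcγ : 0 < c ^ γ := Real.rpow_pos_of_pos hc _
    have hbγ : 0 < b ^ (1 / a * γ) := Real.rpow_pos_of_pos hb _
    calc b * b ^ (1 / a * γ)
        ≤ 2 * (2 ^ γ * (r ^ γ / (c ^ γ * b ^ (1 / a * γ)))) * B * b ^ (1 / a * γ) := by gcongr
      _ = _ := by field_simp

/-- At least half of the potential at `x` comes from distances `≥ c * (potential)^{1/a}`, and this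
forces a Harnack-type inequality. -/
lemma exists_setPotential_harnack (n : ℕ) (hn : 1 ≤ n) {γ : ℝ} (hγ : 0 < γ) (hγn : γ < n) :
    ∃ c : ℝ, 0 < c ∧ ∀ G : Set (EuclideanSpace ℝ (Fin n)), MeasurableSet G → volume G < ⊤ →
      (∀ x, setPotential γ G x ≤ 2 * ∫⁻ y in G, {y | c * (setPotential γ G x).toReal ^
        (1 / ((n : ℝ) - γ)) ≤ dist y x}.indicator (fun y => ENNReal.ofReal (dist y x ^ (-γ))) y) ∧
      ∀ x y, 0 < (setPotential γ G x).toReal → (setPotential γ G x).toReal ≤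
        2 * (1 + dist y x / (c * (setPotential γ G x).toReal ^ (1 / ((n : ℝ) - γ)))) ^ γ *
          (setPotential γ G y).toReal := by
  obtain ⟨C, hC, hCb⟩ := exists_setPotential_ball_le n hn hγ hγn
  obtain ⟨D, hD, hDb⟩ := exists_setPotential_le_volume_rpow n hn hγ hγn
  have ha : 0 < (n : ℝ) - γ := by linarith
  have hn0 : (0 : ℝ) < n := by exact_mod_cast hn
  have : Nonempty (Fin n) := ⟨⟨0, hn⟩⟩
  set c := (1 / (2 * C)) ^ (1 / ((n : ℝ) - γ)) with hc
  have hc0 : 0 < c := by positivity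
  refine ⟨c, hc0, fun G hG hGv => ?_⟩
  have hfin : ∀ x, setPotential γ G x ≠ ⊤ := fun x => ((hDb G x hGv).trans_lt
    (ENNReal.mul_lt_top ENNReal.ofReal_lt_top
      (ENNReal.rpow_lt_top_of_nonneg (by positivity) hGv.ne))).ne
  have hfirst : ∀ x, setPotential γ G x ≤ 2 * ∫⁻ y in G, {y | c * (setPotential γ G x).toReal ^
        (1 / ((n : ℝ) - γ)) ≤ dist y x}.indicator
        (fun y => ENNReal.ofReal (dist y x ^ (-γ))) y := by
    intro x
    set b := (setPotential γ G x).toReal with hb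
    have hbe : setPotential γ G x = ENNReal.ofReal b := (ENNReal.ofReal_toReal (hfin x)).symm
    have hbn : 0 ≤ b := ENNReal.toReal_nonneg
    rcases hbn.eq_or_lt with h0 | h0
    · rw [hbe, ← h0]; simp
    set R := c * b ^ (1 / ((n : ℝ) - γ)) with hR
    have hR0 : 0 < R := by positivity
    have hmeas : MeasurableSet {y | R ≤ dist y x} :=
      measurableSet_le measurable_const (measurable_id.dist measurable_const)
    have hsplit : setPotential γ G x ≤ setPotential γ (Metric.ball x R) x +
        ∫⁻ y in G, {y | R ≤ dist y x}.indicator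
          (fun y => ENNReal.ofReal (dist y x ^ (-γ))) y := by
      rw [lintegral_indicator hmeas, Measure.restrict_restrict hmeas]
      refine le_trans (lintegral_mono_set ?_) (lintegral_union_le _ _ _)
      intro y hy
      rcases lt_or_ge (dist y x) R with h | h
      · exact Or.inl h
      · exact Or.inr ⟨h, hy⟩
    have hRa : C * R ^ ((n : ℝ) - γ) = b / 2 := by
      rw [hR, Real.mul_rpow hc0.le (by positivity), hc, ← Real.rpow_mul (by positivity),
        ← Real.rpow_mul h0.le, one_div_mul_cancel ha.ne', Real.rpow_one, Real.rpow_one]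
      field_simp
    have hball := hCb x R hR0
    rw [hRa] at hball
    set I := ∫⁻ y in G, {y | R ≤ dist y x}.indicator
          (fun y => ENNReal.ofReal (dist y x ^ (-γ))) y with hI
    have h3 : ENNReal.ofReal (b / 2) + ENNReal.ofReal (b / 2) ≤ ENNReal.ofReal (b / 2) + I := by
      rw [← ENNReal.ofReal_add (by positivity) (by positivity), add_halves, ← hbe]
      exact hsplit.trans (by gcongr)
    have h4 : ENNReal.ofReal (b / 2) ≤ I := (ENNReal.add_le_add_iff_left (by simp)).1 h3
    rw [hbe, show b = 2 * (b / 2) by ring, ENNReal.ofReal_mul (by norm_num)]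
    gcongr
    simp
  refine ⟨hfirst, fun x y hb0 => ?_⟩
  have h1 := hfirst x
  set b := (setPotential γ G x).toReal with hb
  set R := c * b ^ (1 / ((n : ℝ) - γ)) with hR
  have hR0 : 0 < R := by positivity
  set r := dist y x with hr
  have hK : 0 ≤ (1 + r / R) ^ γ := Real.rpow_nonneg (by positivity) _
  have hpt : ∫⁻ z in G, {z | R ≤ dist z x}.indicator
      (fun z => ENNReal.ofReal (dist z x ^ (-γ))) z ≤
      ∫⁻ z in G, ENNReal.ofReal ((1 + r / R) ^ γ) * ENNReal.ofReal (dist z y ^ (-γ)) := by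
    have hne : ∀ᵐ z ∂(volume.restrict G), z ≠ y := by
      refine ae_restrict_of_ae ?_
      simp [ae_iff]
    refine lintegral_mono_ae ?_
    filter_upwards [hne] with z hz
    refine indicator_apply_le' (fun hzR => ?_) (fun _ => bot_le)
    have hzR' : R ≤ dist z x := hzR
    have hzx : 0 < dist z x := hR0.trans_le hzR'
    rw [← ENNReal.ofReal_mul hK]
    refine ENNReal.ofReal_le_ofReal ?_
    have hzy : 0 < dist z y := dist_pos.2 hz
    have hle : dist z y ≤ (1 + r / R) * dist z x := by
      have : r ≤ r / R * dist z x := by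
        rw [div_mul_eq_mul_div, le_div_iff₀ hR0]
        gcongr
      have := dist_triangle_right z y x
      linarith
    have h2 : dist z y ^ γ ≤ (1 + r / R) ^ γ * dist z x ^ γ := by
      rw [← Real.mul_rpow (by positivity) hzx.le]
      gcongr
    rw [Real.rpow_neg hzx.le, Real.rpow_neg hzy.le, ← div_eq_mul_inv, inv_eq_one_div,
      div_le_div_iff₀ (by positivity) (by positivity), one_mul]
    exact h2
  rw [lintegral_const_mul' _ _ ENNReal.ofReal_ne_top] at hpt
  have h3 : setPotential γ G x ≤ 2 * (ENNReal.ofReal ((1 + r / R) ^ γ) * setPotential γ G y) :=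
    h1.trans (by gcongr; exact hpt)
  have h4 := ENNReal.toReal_mono (ENNReal.mul_ne_top (by simp)
    (ENNReal.mul_ne_top ENNReal.ofReal_ne_top (hfin y))) h3
  rwa [ENNReal.toReal_mul, ENNReal.toReal_mul, ENNReal.toReal_ofReal hK, ← mul_assoc,
    ENNReal.toReal_ofNat] at h4

/-- Endpoint trace inequality for potentials of characteristic functions:
`∫ (I_a χ_G)^p dμ ≤ C |G|` with `p = (n - d) / a`, `a = n - γ`. -/
lemma exists_lintegral_setPotential_rpow_le (n : ℕ) (hn : 1 ≤ n) {γ d A : ℝ} (hγn : γ < n)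
    (hd : 0 < d) (hdγ : d < γ) (hA : 0 ≤ A) (μ : Measure (EuclideanSpace ℝ (Fin n))) [SFinite μ]
    (hμ : ∀ (x : EuclideanSpace ℝ (Fin n)) (r : ℝ), 0 < r →
      μ (Metric.ball x r) ≤ ENNReal.ofReal (A * r ^ d)) :
    ∃ C : ℝ, 0 ≤ C ∧ ∀ G : Set (EuclideanSpace ℝ (Fin n)), MeasurableSet G → volume G < ⊤ →
      ∫⁻ x, setPotential γ G x ^ ((n - d) / (n - γ)) ∂μ ≤ ENNReal.ofReal C * volume G := by
  have hγ : 0 < γ := hd.trans hdγ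
  obtain ⟨c, hc, hmain⟩ := exists_setPotential_harnack n hn hγ hγn
  obtain ⟨D, hD, hDb⟩ := exists_setPotential_le_volume_rpow n hn hγ hγn
  have hn0 : (0 : ℝ) < n := by exact_mod_cast hn
  set a : ℝ := n - γ with ha_def
  have ha : 0 < a := by linarith
  set q : ℝ := (γ - d) / n with hq
  have hq0 : 0 < q := div_pos (by linarith) hn0
  set γ' : ℝ := γ * (1 - q) with hγ'
  have hγ'd : γ' - d = a * q := by
    rw [hγ', hq, ha_def]; field_simp; ring
  have hγ'0 : 0 < γ' := by have := mul_pos ha hq0; linarith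
  have hnaγ : (a + γ) / a * ((γ - d) / (n : ℝ)) = (γ - d) / a := by
    rw [show a + γ = n by rw [ha_def]; ring]; field_simp
  set K : ℝ := 2 * 2 ^ γ * c ^ (-γ) with hK
  have hK0 : 0 < K := by positivity
  set c' : ℝ := c * (2 * 2 ^ γ) ^ (-(1 / a)) with hc'
  have hc'0 : 0 < c' := by positivity
  set CJ : ℝ := K ^ q * (A * γ' / (a * q)) * c' ^ (-(a * q)) with hCJ
  have hCJ0 : 0 ≤ CJ := by positivity
  refine ⟨2 * CJ, by positivity, fun G hG hGv => ?_⟩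
  obtain ⟨hfirst, hharnack⟩ := hmain G hG hGv
  have hfin : ∀ x, setPotential γ G x ≠ ⊤ := fun x => ((hDb G x hGv).trans_lt
    (ENNReal.mul_lt_top ENNReal.ofReal_lt_top
      (ENNReal.rpow_lt_top_of_nonneg (by positivity) hGv.ne))).ne
  set b : EuclideanSpace ℝ (Fin n) → ℝ := fun x => (setPotential γ G x).toReal with hb
  have hbm : Measurable b := (measurable_setPotential γ G).ennreal_toReal
  have hb0 : ∀ x, 0 ≤ b x := fun x => ENNReal.toReal_nonneg
  set s : ℝ := (γ - d) / a with hs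
  have hs0 : 0 < s := div_pos (by linarith) ha
  let S : Set (EuclideanSpace ℝ (Fin n) × EuclideanSpace ℝ (Fin n)) :=
    {p | c * b p.1 ^ (1 / a) ≤ dist p.2 p.1}
  have hS : MeasurableSet S := measurableSet_le
    (((hbm.comp measurable_fst).pow_const _).const_mul _) (measurable_snd.dist measurable_fst)
  let Φ : EuclideanSpace ℝ (Fin n) × EuclideanSpace ℝ (Fin n) → ℝ≥0∞ := S.indicator
    fun p => ENNReal.ofReal (dist p.2 p.1 ^ (-γ))
  have hΦ : Measurable Φ :=
    (((measurable_snd.dist measurable_fst).pow_const _).ennreal_ofReal).indicator hS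
  have hJ : ∀ y, ∫⁻ x, ENNReal.ofReal (b x ^ s) * Φ (x, y) ∂μ ≤ ENNReal.ofReal CJ := by
    intro y
    rcases (hb0 y).eq_or_lt with hy0 | hy0
    · have : ∀ x, ENNReal.ofReal (b x ^ s) * Φ (x, y) = 0 := by
        intro x
        have : b x = 0 := by
          by_contra hne
          have hpos : 0 < b x := lt_of_le_of_ne (hb0 x) (Ne.symm hne)
          have := hharnack x y hpos
          simp only [hb] at hy0 hpos
          rw [← hy0, mul_zero] at this
          linarith
        rw [this, Real.zero_rpow hs0.ne']; simp
      simp [this]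
    · set B := b y with hB
      have hR0 : 0 < c' * B ^ (1 / a) := by positivity
      have hpt : ∀ x, ENNReal.ofReal (b x ^ s) * Φ (x, y) ≤
          (Metric.ball y (c' * B ^ (1 / a)))ᶜ.indicator (fun x =>
            ENNReal.ofReal ((K * B) ^ q) * ENNReal.ofReal (dist x y ^ (-γ'))) x := by
        intro x
        rcases (hb0 x).eq_or_lt with hx0 | hx0
        · rw [← hx0, Real.zero_rpow hs0.ne']; simp
        by_cases hxy : (x, y) ∈ S
        · have hxy' : c * b x ^ (1 / a) ≤ dist y x := hxy
          have hr0 : 0 < dist y x := lt_of_lt_of_le (by positivity) hxy'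
          obtain ⟨h1, h2⟩ := rpow_comparison ha hγ hc hx0 hy0 hxy' (hharnack x y hx0)
            (by have := hharnack y x hy0; rwa [dist_comm] at this)
          rw [indicator_of_mem (by
            rw [mem_compl_iff, Metric.mem_ball, not_lt, dist_comm]; exact h1)]
          simp only [Φ]
          rw [indicator_of_mem hxy, ← ENNReal.ofReal_mul (by positivity),
            ← ENNReal.ofReal_mul (by positivity)]
          refine ENNReal.ofReal_le_ofReal ?_
          have h3 : b x ^ s ≤ (K * B) ^ q * dist y x ^ (γ * q) := by
            calc b x ^ s = (b x ^ ((a + γ) / a)) ^ q := by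
                  rw [← Real.rpow_mul hx0.le, hq, hnaγ]
              _ ≤ (K * dist y x ^ γ * B) ^ q := by gcongr
              _ = _ := by
                  rw [show K * dist y x ^ γ * B = K * B * dist y x ^ γ by ring,
                    Real.mul_rpow (by positivity) (by positivity), ← Real.rpow_mul hr0.le]
          calc b x ^ s * dist y x ^ (-γ)
              ≤ (K * B) ^ q * dist y x ^ (γ * q) * dist y x ^ (-γ) := by gcongr
            _ = (K * B) ^ q * dist x y ^ (-γ') := by
                rw [mul_assoc, ← Real.rpow_add hr0, dist_comm x y, hγ']
                ring_nf
        · simp only [Φ]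
          rw [indicator_of_notMem hxy, mul_zero]
          exact bot_le
      refine (lintegral_mono hpt).trans ?_
      rw [lintegral_indicator measurableSet_ball.compl,
        lintegral_const_mul' _ _ ENNReal.ofReal_ne_top]
      refine (mul_le_mul_right (lintegral_compl_ball_dist_rpow_le μ y hA (hμ y) hγ'0
        (by have := mul_pos ha hq0; linarith) hR0) _).trans ?_
      rw [← ENNReal.ofReal_mul (by positivity)]
      refine ENNReal.ofReal_le_ofReal (le_of_eq ?_)
      rw [hγ'd, Real.mul_rpow hK0.le hy0.le, Real.mul_rpow hc'0.le (by positivity),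
        ← Real.rpow_mul hy0.le, hCJ]
      have : B ^ q * B ^ (1 / a * -(a * q)) = 1 := by
        rw [← Real.rpow_add hy0]
        rw [show q + 1 / a * -(a * q) = 0 by field_simp; ring, Real.rpow_zero]
      calc _ = K ^ q * (A * γ' / (a * q)) * c' ^ (-(a * q)) *
            (B ^ q * B ^ (1 / a * -(a * q))) := by ring
        _ = _ := by rw [this, mul_one]
  have hp : (n - d) / a = s + 1 := by
    rw [hs, div_add_one ha.ne']
    congr 1
    rw [ha_def]; ring
  have hpt : ∀ x, setPotential γ G x ^ ((n - d) / a) ≤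
      2 * ∫⁻ y in G, ENNReal.ofReal (b x ^ s) * Φ (x, y) := by
    intro x
    rw [lintegral_const_mul' _ _ ENNReal.ofReal_ne_top, mul_left_comm, hp,
      ENNReal.rpow_add_of_nonneg _ _ hs0.le zero_le_one, ENNReal.rpow_one]
    have hbe : setPotential γ G x = ENNReal.ofReal (b x) := (ENNReal.ofReal_toReal (hfin x)).symm
    refine mul_le_mul' (le_of_eq ?_) (hfirst x)
    rw [hbe, ENNReal.ofReal_rpow_of_nonneg (hb0 x) hs0.le]
  refine (lintegral_mono hpt).trans ?_
  rw [lintegral_const_mul' _ _ (by simp), lintegral_lintegral_swap]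
  · calc 2 * ∫⁻ y in G, ∫⁻ x, ENNReal.ofReal (b x ^ s) * Φ (x, y) ∂μ
        ≤ 2 * ∫⁻ y in G, ENNReal.ofReal CJ := by gcongr; exact hJ _
      _ = _ := by
        rw [setLIntegral_const, ENNReal.ofReal_mul (p := 2) (q := CJ) (by norm_num), mul_assoc,
          ENNReal.ofReal_ofNat]
  · exact (((hbm.comp measurable_fst).pow_const _).ennreal_ofReal.mul hΦ).aemeasurable

lemma enorm_le_lintegral_Ioi_deriv {ψ : ℝ → ℝ} (hψ : ContDiff ℝ (⊤ : ℕ∞) ψ)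
    (hc : HasCompactSupport ψ) (t : ℝ) : ‖ψ t‖ₑ ≤ ∫⁻ s in Ioi t, ‖deriv ψ s‖ₑ := by
  rw [← enorm_neg (ψ t), ← HasCompactSupport.integral_Ioi_deriv_eq (hψ.of_le (by simp)) hc t]
  exact enorm_integral_le_lintegral_enorm _

lemma enorm_le_lintegral_pow_mul_iteratedDeriv {φ : ℝ → ℝ} (hφ : ContDiff ℝ (⊤ : ℕ∞) φ)
    (hc : HasCompactSupport φ) (k : ℕ) :
    ‖φ 0‖ₑ ≤ ∫⁻ t in Ioi (0 : ℝ), ENNReal.ofReal (t ^ k) * ‖deriv^[k + 1] φ t‖ₑ := by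
  have hs : ∀ j, HasCompactSupport (deriv^[j] φ) := by
    intro j
    induction j with
    | zero => exact hc
    | succ j ih => rw [Function.iterate_succ_apply']; exact ih.deriv
  induction k with
  | zero => simpa using enorm_le_lintegral_Ioi_deriv hφ hc 0
  | succ k ih =>
    let F : ℝ × ℝ → ℝ≥0∞ := {p : ℝ × ℝ | p.1 < p.2}.indicator
      fun p => ENNReal.ofReal (p.1 ^ k) * ‖deriv^[k + 2] φ p.2‖ₑ
    have hcont : Continuous (deriv^[k + 2] φ) := (hφ.iterate_deriv (k + 2)).continuous
    have hF : Measurable F := by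
      refine Measurable.indicator ?_ (measurableSet_lt measurable_fst measurable_snd)
      exact ((measurable_fst.pow_const _).ennreal_ofReal).mul
        (hcont.measurable.comp measurable_snd).enorm
    refine ih.trans ?_
    calc ∫⁻ t in Ioi (0 : ℝ), ENNReal.ofReal (t ^ k) * ‖deriv^[k + 1] φ t‖ₑ
        ≤ ∫⁻ t in Ioi (0 : ℝ), ∫⁻ s in Ioi (0 : ℝ), F (t, s) := by
          refine setLIntegral_mono' measurableSet_Ioi fun t ht => ?_
          have h1 := enorm_le_lintegral_Ioi_deriv (hφ.iterate_deriv (k + 1)) (hs (k + 1)) t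
          refine (mul_le_mul_right h1 _).trans ?_
          rw [← lintegral_const_mul' _ _ ENNReal.ofReal_ne_top,
            ← lintegral_indicator measurableSet_Ioi, ← lintegral_indicator measurableSet_Ioi]
          refine lintegral_mono fun s => indicator_apply_le' (fun hst => ?_) (fun _ => bot_le)
          rw [indicator_of_mem (show s ∈ Ioi 0 from lt_trans (show (0:ℝ) < t from ht) (show t < s from hst))]
          simp only [F]
          rw [indicator_of_mem (show (t, s) ∈ {p : ℝ × ℝ | p.1 < p.2} from hst),
            Function.iterate_succ_apply' deriv (k + 1)]
      _ = ∫⁻ s in Ioi (0 : ℝ), ∫⁻ t in Ioi (0 : ℝ), F (t, s) :=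
          lintegral_lintegral_swap hF.aemeasurable
      _ ≤ _ := by
          refine setLIntegral_mono' measurableSet_Ioi fun s hs0 => ?_
          have hs0' : 0 < s := hs0
          calc ∫⁻ t in Ioi (0 : ℝ), F (t, s)
              ≤ ∫⁻ t in Ioo 0 s, ENNReal.ofReal (s ^ k) * ‖deriv^[k + 2] φ s‖ₑ := by
                rw [← lintegral_indicator measurableSet_Ioi,
                  ← lintegral_indicator measurableSet_Ioo]
                refine lintegral_mono fun t => indicator_apply_le' (fun ht => ?_) (fun _ => bot_le)
                refine indicator_apply_le' (fun hts => ?_) (fun _ => bot_le)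
                have ht0 : 0 < t := ht
                have hts' : t < s := hts
                rw [indicator_of_mem (show t ∈ Ioo 0 s from ⟨ht0, hts'⟩)]
                gcongr
            _ = _ := by
                rw [setLIntegral_const, Real.volume_Ioo, sub_zero, pow_succ,
                  ENNReal.ofReal_mul (by positivity)]
                ring

lemma enorm_iterate_deriv_line_le {n : ℕ} {u : EuclideanSpace ℝ (Fin n) → ℝ}
    (hu : ContDiff ℝ (⊤ : ℕ∞) u) (x v : EuclideanSpace ℝ (Fin n)) (m : ℕ) (t : ℝ) :
    ‖deriv^[m] (fun s : ℝ => u (x + s • v)) t‖ₑ ≤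
      ENNReal.ofReal (‖v‖ ^ m) * ENNReal.ofReal ‖iteratedFDeriv ℝ m u (x + t • v)‖ := by
  rw [← ENNReal.ofReal_mul (by positivity), ← ofReal_norm]
  refine ENNReal.ofReal_le_ofReal ?_
  rw [← iteratedDeriv_eq_iterate, ← norm_iteratedFDeriv_eq_norm_iteratedDeriv]
  let L : ℝ →L[ℝ] EuclideanSpace ℝ (Fin n) := ContinuousLinearMap.toSpanSingleton ℝ v
  have h1 : (fun s : ℝ => u (x + s • v)) = (fun z => u (x + z)) ∘ L := by
    ext s; simp [L]
  have hux : ContDiff ℝ (⊤ : ℕ∞) (fun z => u (x + z)) := hu.comp (contDiff_const.add contDiff_id)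
  rw [h1, L.iteratedFDeriv_comp_right hux t (by exact_mod_cast le_top),
    iteratedFDeriv_comp_add_left]
  refine (ContinuousMultilinearMap.norm_compContinuousLinearMap_le _ _).trans ?_
  simp [L, mul_comm, ContinuousLinearMap.norm_toSpanSingleton]

lemma lintegral_comp_add_smul {n : ℕ} {F : EuclideanSpace ℝ (Fin n) → ℝ≥0∞} (hF : Measurable F)
    (x : EuclideanSpace ℝ (Fin n)) {t : ℝ} (ht : 0 < t) :
    ∫⁻ v, F (x + t • v) = ENNReal.ofReal ((t ^ n)⁻¹) * ∫⁻ w, F w := by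
  rw [← lintegral_add_left_eq_self F x]
  have hm : Measurable fun w => F (x + w) := hF.comp (measurable_const_add x)
  rw [← lintegral_map hm (measurable_const_smul t), Measure.map_addHaar_smul _ ht.ne',
    lintegral_smul_measure, finrank_euclideanSpace, Fintype.card_fin,
    abs_of_pos (by positivity)]
  rfl

/-- Pointwise bound of a test function by the Riesz potential of its `m`-th gradient. -/
lemma exists_enorm_le_riesz (n m : ℕ) (hm : 1 ≤ m) (hmn : m < n) :
    ∃ K : ℝ, 0 ≤ K ∧ ∀ u : EuclideanSpace ℝ (Fin n) → ℝ, ContDiff ℝ (⊤ : ℕ∞) u →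
      HasCompactSupport u → ∀ x, ENNReal.ofReal |u x| ≤ ENNReal.ofReal K *
        ∫⁻ y, ENNReal.ofReal (dist y x ^ (-((n : ℝ) - m))) *
          ENNReal.ofReal ‖iteratedFDeriv ℝ m u y‖ := by
  have : Nonempty (Fin n) := ⟨⟨0, by omega⟩⟩
  let S : Set (EuclideanSpace ℝ (Fin n)) := {v | 1 < ‖v‖ ∧ ‖v‖ < 2}
  have hSo : IsOpen S := (isOpen_lt continuous_const continuous_norm).inter
    (isOpen_lt continuous_norm continuous_const)
  have hSne : S.Nonempty := by
    obtain ⟨v, hv⟩ := exists_norm_eq (EuclideanSpace ℝ (Fin n)) (show (0 : ℝ) ≤ 3 / 2 by norm_num)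
    exact ⟨v, by simp only [S, mem_ofPred_eq, hv]; norm_num⟩
  have hS0 : volume S ≠ 0 := (hSo.measure_pos volume hSne).ne'
  have hSt : volume S ≠ ⊤ := by
    refine ((measure_mono (t := Metric.ball 0 2) ?_).trans_lt measure_ball_lt_top).ne
    intro v hv
    simpa using hv.2
  obtain ⟨k, rfl⟩ : ∃ k, m = k + 1 := ⟨m - 1, by omega⟩
  set κ : ℝ := 2 ^ (k + 1) * 2 ^ n with hκ
  have hκ0 : 0 ≤ κ := by positivity
  refine ⟨κ / (volume S).toReal, by positivity, fun u hu hcs x => ?_⟩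
  have hgc : Continuous fun y => ‖iteratedFDeriv ℝ (k + 1) u y‖ :=
    (hu.continuous_iteratedFDeriv (by exact_mod_cast le_top)).norm
  set g : EuclideanSpace ℝ (Fin n) → ℝ≥0∞ :=
    fun y => ENNReal.ofReal ‖iteratedFDeriv ℝ (k + 1) u y‖ with hg
  have hgm : Measurable g := hgc.measurable.ennreal_ofReal
  let F : ℝ × EuclideanSpace ℝ (Fin n) → ℝ≥0∞ :=
    {p : ℝ × EuclideanSpace ℝ (Fin n) | p.1 < dist p.2 x ∧ dist p.2 x < 2 * p.1}.indicator
      fun p => g p.2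
  have hF : Measurable F := by
    refine Measurable.indicator (hgm.comp measurable_snd) ?_
    exact (measurableSet_lt measurable_fst (measurable_snd.dist measurable_const)).inter
      (measurableSet_lt (measurable_snd.dist measurable_const) (measurable_fst.const_mul _))
  have hline : ∀ v ∈ S, ‖u x‖ₑ ≤ ∫⁻ t in Ioi (0 : ℝ),
      ENNReal.ofReal (2 ^ (k + 1) * t ^ k) * F (t, x + t • v) := by
    intro v hv
    have hv0 : v ≠ 0 := by
      rintro rfl
      have := hv.1
      simp only [norm_zero] at this
      linarith
    have hc : HasCompactSupport fun s : ℝ => u (x + s • v) :=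
      hcs.comp_isClosedEmbedding
        ((Homeomorph.addLeft x).isClosedEmbedding.comp (isClosedEmbedding_smul_left hv0))
    have hd : ContDiff ℝ (⊤ : ℕ∞) fun s : ℝ => u (x + s • v) :=
      hu.comp (contDiff_const.add (contDiff_id.smul contDiff_const))
    have h1 := enorm_le_lintegral_pow_mul_iteratedDeriv hd hc k
    simp only [zero_smul, add_zero] at h1
    refine h1.trans (setLIntegral_mono' measurableSet_Ioi fun t ht => ?_)
    have ht0 : 0 < t := ht
    have hmem : (t, x + t • v) ∈
        {p : ℝ × EuclideanSpace ℝ (Fin n) | p.1 < dist p.2 x ∧ dist p.2 x < 2 * p.1} := by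
      have : dist (x + t • v) x = t * ‖v‖ := by
        rw [dist_eq_norm, add_sub_cancel_left, norm_smul, Real.norm_of_nonneg ht0.le]
      simp only [mem_ofPred_eq, this]
      constructor <;> nlinarith [hv.1, hv.2]
    simp only [F]
    rw [indicator_of_mem hmem]
    refine (mul_le_mul_right (enorm_iterate_deriv_line_le hu x v (k + 1) t) _).trans ?_
    rw [← mul_assoc, ← ENNReal.ofReal_mul (by positivity), mul_comm (t ^ k)]
    gcongr
    exact hv.2.le
  have hinner : ∀ w, ∫⁻ t in Ioi (0 : ℝ),
      ENNReal.ofReal (2 ^ (k + 1) * t ^ k * (t ^ n)⁻¹) * F (t, w) ≤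
      ENNReal.ofReal κ * (ENNReal.ofReal (dist w x ^ (-((n : ℝ) - (k + 1 : ℕ)))) * g w) := by
    intro w
    set r := dist w x with hr
    have hr0 : 0 ≤ r := dist_nonneg
    calc ∫⁻ t in Ioi (0 : ℝ), ENNReal.ofReal (2 ^ (k + 1) * t ^ k * (t ^ n)⁻¹) * F (t, w)
        ≤ ∫⁻ t in Ioo 0 r, ENNReal.ofReal (2 ^ (k + 1) * r ^ k * ((r / 2) ^ n)⁻¹) * g w := by
          rw [← lintegral_indicator measurableSet_Ioi, ← lintegral_indicator measurableSet_Ioo]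
          refine lintegral_mono fun t => indicator_apply_le' (fun ht => ?_) (fun _ => bot_le)
          have ht0 : 0 < t := ht
          by_cases hmem : (t, w) ∈
            {p : ℝ × EuclideanSpace ℝ (Fin n) | p.1 < dist p.2 x ∧ dist p.2 x < 2 * p.1}
          · simp only [F]
            rw [indicator_of_mem hmem]
            obtain ⟨h1, h2⟩ := hmem
            simp only [← hr] at h1 h2
            have hrp : 0 < r := ht0.trans h1
            rw [indicator_of_mem (show t ∈ Ioo 0 r from ⟨ht0, h1⟩)]
            gcongr
            linarith
          · simp only [F]
            rw [indicator_of_notMem hmem, mul_zero]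
            exact bot_le
      _ = _ := by
          rw [setLIntegral_const, Real.volume_Ioo, sub_zero, mul_right_comm, ← mul_assoc,
            ← ENNReal.ofReal_mul (by positivity), ← ENNReal.ofReal_mul hκ0]
          rcases hr0.eq_or_lt with h0 | h0
          · have : (0 : ℝ) ^ (-((n : ℝ) - (k + 1 : ℕ))) = 0 := by
              refine Real.zero_rpow (neg_ne_zero.2 (sub_ne_zero.2 ?_))
              exact_mod_cast hmn.ne'
            rw [← h0, this]; simp
          · congr 2
            rw [neg_sub, Real.rpow_sub h0, Real.rpow_natCast, Real.rpow_natCast, hκ, div_pow,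
              pow_succ r k]
            field_simp
  have htot : ‖u x‖ₑ * volume S ≤ ENNReal.ofReal κ *
      ∫⁻ y, ENNReal.ofReal (dist y x ^ (-((n : ℝ) - (k + 1 : ℕ)))) * g y := by
    calc ‖u x‖ₑ * volume S = ∫⁻ v in S, ‖u x‖ₑ := by rw [setLIntegral_const]
      _ ≤ ∫⁻ v in S, ∫⁻ t in Ioi (0 : ℝ),
            ENNReal.ofReal (2 ^ (k + 1) * t ^ k) * F (t, x + t • v) :=
          setLIntegral_mono' hSo.measurableSet hline
      _ ≤ ∫⁻ v, ∫⁻ t in Ioi (0 : ℝ),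
            ENNReal.ofReal (2 ^ (k + 1) * t ^ k) * F (t, x + t • v) := setLIntegral_le_lintegral _ _
      _ = ∫⁻ t in Ioi (0 : ℝ), ∫⁻ v,
            ENNReal.ofReal (2 ^ (k + 1) * t ^ k) * F (t, x + t • v) := by
          refine lintegral_lintegral_swap (Measurable.aemeasurable ?_)
          refine Measurable.mul (by fun_prop) (hF.comp ?_)
          fun_prop
      _ = ∫⁻ t in Ioi (0 : ℝ), ∫⁻ w,
            ENNReal.ofReal (2 ^ (k + 1) * t ^ k * (t ^ n)⁻¹) * F (t, w) := by
          refine setLIntegral_congr_fun measurableSet_Ioi fun t ht => ?_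
          have ht0 : 0 < t := ht
          rw [lintegral_const_mul' _ _ ENNReal.ofReal_ne_top,
            lintegral_const_mul' _ _ ENNReal.ofReal_ne_top,
            lintegral_comp_add_smul (F := fun w => F (t, w)) (hF.comp measurable_prodMk_left) x ht0,
            ← mul_assoc, ← ENNReal.ofReal_mul (by positivity)]
      _ = ∫⁻ w, ∫⁻ t in Ioi (0 : ℝ),
            ENNReal.ofReal (2 ^ (k + 1) * t ^ k * (t ^ n)⁻¹) * F (t, w) := by
          refine lintegral_lintegral_swap (Measurable.aemeasurable ?_)
          exact Measurable.mul (by fun_prop) hF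
      _ ≤ _ := by
          rw [← lintegral_const_mul' _ _ ENNReal.ofReal_ne_top]
          exact lintegral_mono hinner
  rw [ENNReal.ofReal_div_of_pos (ENNReal.toReal_pos hS0 hSt), ENNReal.ofReal_toReal hSt,
    ← Real.norm_eq_abs, ofReal_norm, ENNReal.div_eq_inv_mul, mul_assoc]
  rw [← ENNReal.div_eq_inv_mul, ENNReal.le_div_iff_mul_le (Or.inl hS0) (Or.inl hSt)]
  exact htot

/-- The non-increasing rearrangement of an extended-nonnegative function. -/
noncomputable def decreasingRearr {α : Type*} [MeasurableSpace α] (ν : Measure α)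
    (φ : α → ℝ≥0∞) (s : ℝ) : ℝ≥0∞ :=
  sInf {ρ : ℝ≥0∞ | ν {x | ρ < φ x} ≤ ENNReal.ofReal s}

section Rearrangement

variable {α : Type*} [MeasurableSpace α] {ν : Measure α} {φ ψ : α → ℝ≥0∞}

lemma antitone_decreasingRearr (ν : Measure α) (φ : α → ℝ≥0∞) :
    Antitone (decreasingRearr ν φ) := fun _ _ hst =>
  sInf_le_sInf fun _ hρ => le_trans hρ (ENNReal.ofReal_le_ofReal hst)

lemma le_decreasingRearr {c : ℝ≥0∞} {s : ℝ} (h : ENNReal.ofReal s < ν {x | c < φ x}) :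
    c ≤ decreasingRearr ν φ s := by
  refine le_sInf fun ρ hρ => le_of_not_gt fun hlt => ?_
  exact absurd (lt_of_lt_of_le h ((measure_mono fun x hx => hlt.trans hx).trans hρ)) (lt_irrefl _)

lemma lt_measure_of_lt_decreasingRearr {c : ℝ≥0∞} {s : ℝ} (h : c < decreasingRearr ν φ s) :
    ENNReal.ofReal s < ν {x | c < φ x} := by
  by_contra hc
  exact absurd (lt_of_lt_of_le h (sInf_le (not_lt.1 hc))) (lt_irrefl _)

lemma decreasingRearr_le_add {a : ℝ≥0∞} (h : ∀ x, φ x ≤ a + ψ x) (s : ℝ) :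
    decreasingRearr ν φ s ≤ a + decreasingRearr ν ψ s := by
  unfold decreasingRearr
  rw [ENNReal.add_sInf]
  refine le_iInf₂ fun ρ hρ => sInf_le ?_
  refine le_trans (measure_mono fun x hx => ?_) hρ
  by_contra hc
  exact absurd (lt_of_lt_of_le (show a + ρ < φ x from hx)
    ((h x).trans (add_le_add_right (not_lt.1 hc) a))) (lt_irrefl _)

lemma volume_Ioi_inter_ofReal_le (c : ℝ≥0∞) :
    volume {σ : ℝ | 0 < σ ∧ ENNReal.ofReal σ ≤ c} ≤ c := by
  rcases eq_or_ne c ⊤ with rfl | hc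
  · exact le_top
  · calc volume {σ : ℝ | 0 < σ ∧ ENNReal.ofReal σ ≤ c} ≤ volume (Ioc 0 c.toReal) :=
          measure_mono fun σ hσ => ⟨hσ.1, (ENNReal.ofReal_le_iff_le_toReal hc).1 hσ.2⟩
      _ = c := by rw [Real.volume_Ioc, sub_zero, ENNReal.ofReal_toReal hc]

lemma volume_Ioi_inter_ofReal_lt {M : ℝ} (hM : 0 < M) (c : ℝ≥0∞) :
    volume {s : ℝ | 0 < s ∧ ENNReal.ofReal (M * s) < c} ≤ (ENNReal.ofReal M)⁻¹ * c := by
  refine (measure_mono ?_).trans (volume_Ioi_inter_ofReal_le _)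
  intro s hs
  refine ⟨hs.1, ?_⟩
  have hM' : ENNReal.ofReal M ≠ 0 := (ENNReal.ofReal_pos.2 hM).ne'
  rw [← ENNReal.mul_le_iff_le_inv hM' ENNReal.ofReal_ne_top, ← ENNReal.ofReal_mul hM.le]
  exact hs.2.le

lemma lintegral_decreasingRearr_rpow_le [SFinite ν] (hφ : Measurable φ) {M p : ℝ} (hM : 0 < M)
    (hp : 0 < p) :
    ∫⁻ s in Ioi (0 : ℝ), decreasingRearr ν φ (M * s) ^ p ≤
      (ENNReal.ofReal M)⁻¹ * ∫⁻ x, φ x ^ p ∂ν := by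
  have hm : Measurable fun s : ℝ => decreasingRearr ν φ (M * s) ^ p :=
    ((antitone_decreasingRearr ν φ).measurable.comp (measurable_const_mul M)).pow_const p
  rw [lintegral_eq_lintegral_meas_ofReal_lt _ hm,
    lintegral_eq_lintegral_meas_ofReal_lt _ (hφ.pow_const p),
    ← lintegral_const_mul' _ _ (ENNReal.inv_ne_top.2 (ENNReal.ofReal_pos.2 hM).ne')]
  refine lintegral_mono fun σ => ?_
  have hset : ∀ c : ℝ≥0∞, ENNReal.ofReal σ < c ^ p ↔ ENNReal.ofReal σ ^ p⁻¹ < c := fun c => by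
    rw [ENNReal.rpow_inv_lt_iff hp]
  simp only [hset]
  rw [Measure.restrict_apply' measurableSet_Ioi]
  refine (measure_mono ?_).trans (volume_Ioi_inter_ofReal_lt hM _)
  exact fun s hs => ⟨hs.2, lt_measure_of_lt_decreasingRearr hs.1⟩

end Rearrangement

/-- Minkowski's integral inequality. -/
lemma lintegral_lintegral_rpow_le {α β : Type*} [MeasurableSpace α] [MeasurableSpace β]
    {μ : Measure α} {ν : Measure β} [SFinite μ] [SFinite ν] {H : α → β → ℝ≥0∞}
    (hH : Measurable (Function.uncurry H)) {p : ℝ} (hp : 1 < p)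
    (hfin : ∫⁻ x, (∫⁻ y, H x y ∂ν) ^ p ∂μ ≠ ⊤) :
    (∫⁻ x, (∫⁻ y, H x y ∂ν) ^ p ∂μ) ^ (1 / p) ≤ ∫⁻ y, (∫⁻ x, H x y ^ p ∂μ) ^ (1 / p) ∂ν := by
  set T : α → ℝ≥0∞ := fun x => ∫⁻ y, H x y ∂ν with hT
  have hTm : Measurable T := hH.lintegral_prod_right'
  set J := ∫⁻ x, T x ^ p ∂μ with hJ
  have hp0 : 0 < p := by linarith
  rcases eq_or_ne J 0 with h0 | h0
  · rw [h0, ENNReal.zero_rpow_of_pos (by positivity)]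
    exact bot_le
  set q := p / (p - 1) with hq
  have hpq : p.HolderConjugate q := Real.HolderConjugate.conjExponent hp
  have hTp : ∀ x, (T x ^ (p - 1)) ^ q = T x ^ p := fun x => by
    rw [← ENNReal.rpow_mul, hq, mul_div_cancel₀ _ (by linarith : p - 1 ≠ 0)]
  have key : J ≤ J ^ (1 / q) * ∫⁻ y, (∫⁻ x, H x y ^ p ∂μ) ^ (1 / p) ∂ν := by
    calc J = ∫⁻ x, ∫⁻ y, T x ^ (p - 1) * H x y ∂ν ∂μ := by
          refine lintegral_congr fun x => ?_
          rw [lintegral_const_mul (f := fun y => H x y) _ (hH.comp measurable_prodMk_left)]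
          conv_lhs => rw [show p = (p - 1) + 1 by ring]
          rw [ENNReal.rpow_add_of_nonneg _ _ (by linarith) zero_le_one, ENNReal.rpow_one]
      _ = ∫⁻ y, ∫⁻ x, T x ^ (p - 1) * H x y ∂μ ∂ν :=
          lintegral_lintegral_swap
            (((hTm.comp measurable_fst).pow_const _).mul hH).aemeasurable
      _ ≤ ∫⁻ y, J ^ (1 / q) * (∫⁻ x, H x y ^ p ∂μ) ^ (1 / p) ∂ν := by
          refine lintegral_mono fun y => ?_
          have := ENNReal.lintegral_mul_le_Lp_mul_Lq μ hpq.symm (hTm.pow_const (p - 1)).aemeasurable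
            (hH.comp measurable_prodMk_right : Measurable fun x => H x y).aemeasurable
          simp only [hTp] at this
          exact this
      _ = _ := by
          rw [lintegral_const_mul' _ _ (ENNReal.rpow_ne_top_of_nonneg (by
            have := hpq.symm.pos; positivity) hfin)]
  have hq1 : 1 / p + 1 / q = 1 := by
    have := hpq.inv_add_inv_eq_one
    simpa using this
  have hJq : J ^ (1 / q) ≠ 0 := by
    rw [Ne, ENNReal.rpow_eq_zero_iff]
    rintro (h | h)
    · exact h0 h.1
    · exact hfin h.1
  have hJq' : J ^ (1 / q) ≠ ⊤ := ENNReal.rpow_ne_top_of_nonneg (by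
    have := hpq.symm.pos; positivity) hfin
  rw [← ENNReal.mul_le_mul_iff_right hJq hJq', ← ENNReal.rpow_add _ _ h0 hfin, add_comm, hq1,
    ENNReal.rpow_one]
  exact key

/-- Layer cake formula with a weight. -/
lemma lintegral_mul_eq_lintegral_setLIntegral {α : Type*} [MeasurableSpace α] (ν : Measure α)
    [SFinite ν] {k g : α → ℝ≥0∞} (hk : Measurable k) (hg : Measurable g) :
    ∫⁻ y, k y * g y ∂ν =
      ∫⁻ σ in Ioi (0 : ℝ), ∫⁻ y in {y | ENNReal.ofReal σ < g y}, k y ∂ν := by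
  have h := lintegral_eq_lintegral_meas_ofReal_lt (ν.withDensity k) hg
  rw [lintegral_withDensity_eq_lintegral_mul _ hk hg] at h
  refine h.trans (lintegral_congr fun σ => ?_)
  exact withDensity_apply _ (measurableSet_lt measurable_const hg)

/-- Representation of a power of `D ≤ V` through the power weight. -/
lemma rpow_le_add_lintegral_indicator {V β r R : ℝ} (hV : 0 < V) (hβ : 0 < β) (hr : 0 ≤ r)
    {D : ℝ≥0∞} (hrD : ENNReal.ofReal (V * r) ≤ D) (hDR : D ≤ ENNReal.ofReal (V * R)) :
    D ^ β ≤ ENNReal.ofReal (V ^ β) * (ENNReal.ofReal (r ^ β) + ENNReal.ofReal β *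
      ∫⁻ s in Ioo r R, {s : ℝ | ENNReal.ofReal (V * s) < D}.indicator
        (fun s => ENNReal.ofReal (s ^ (β - 1))) s) := by
  have hDt : D ≠ ⊤ := (hDR.trans_lt ENNReal.ofReal_lt_top).ne
  obtain ⟨h, hh0, rfl⟩ : ∃ h : ℝ, 0 ≤ h ∧ D = ENNReal.ofReal (V * h) := by
    refine ⟨D.toReal / V, by positivity, ?_⟩
    rw [mul_div_cancel₀ _ hV.ne', ENNReal.ofReal_toReal hDt]
  have hrh : r ≤ h := by
    have := (ENNReal.ofReal_le_ofReal_iff (by positivity)).1 hrD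
    exact le_of_mul_le_mul_left this hV
  have hset : Ioo r h ⊆ Ioo r R ∩ {s : ℝ | ENNReal.ofReal (V * s) < ENNReal.ofReal (V * h)} := by
    rintro s ⟨hs1, hs2⟩
    have hlt : ENNReal.ofReal (V * s) < ENNReal.ofReal (V * h) :=
      (ENNReal.ofReal_lt_ofReal_iff (by nlinarith)).2 (by nlinarith)
    refine ⟨⟨hs1, ?_⟩, hlt⟩
    have h2 := hlt.trans_le hDR
    have h3 := (ENNReal.ofReal_lt_ofReal_iff'.1 h2).1
    exact lt_of_mul_lt_mul_left h3 hV.le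
  have hms : MeasurableSet {s : ℝ | ENNReal.ofReal (V * s) < ENNReal.ofReal (V * h)} :=
    measurableSet_lt (by fun_prop) measurable_const
  rw [lintegral_indicator hms, Measure.restrict_restrict hms, inter_comm]
  refine le_trans ?_ (mul_le_mul_right (add_le_add_right (mul_le_mul_right
    (lintegral_mono_set hset) _) _) _)
  rw [lintegral_Ioo_rpow hr hrh (Or.inr hβ) hβ.ne', ← ENNReal.ofReal_mul hβ.le,
    mul_div_cancel₀ _ hβ.ne', ← ENNReal.ofReal_add (by positivity)
      (sub_nonneg.2 (Real.rpow_le_rpow hr hrh hβ.le)), ← ENNReal.ofReal_mul (by positivity),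
    ENNReal.ofReal_rpow_of_nonneg (by positivity) hβ.le, Real.mul_rpow hV.le hh0]
  simp

section Distribution

variable {D : ℝ → ℝ≥0∞} {F : ℝ → ℝ≥0∞} {V : ℝ}

lemma lintegral_lintegral_indicator_le (hD : Measurable D)
    (hF : ∀ s, 0 < s → volume {σ : ℝ | 0 < σ ∧ ENNReal.ofReal (V * s) < D σ} ≤ F s)
    {k : ℝ → ℝ≥0∞} (hk : Measurable k) {r R : ℝ} (hr : 0 ≤ r) :
    ∫⁻ σ in Ioi (0 : ℝ), ∫⁻ s in Ioo r R, {s : ℝ | ENNReal.ofReal (V * s) < D σ}.indicator k s ≤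
      ∫⁻ s in Ioo r R, k s * F s := by
  have hS : MeasurableSet {q : ℝ × ℝ | ENNReal.ofReal (V * q.2) < D q.1} :=
    measurableSet_lt (by fun_prop) (hD.comp measurable_fst)
  have hm : Measurable (Function.uncurry fun σ s : ℝ =>
      {s : ℝ | ENNReal.ofReal (V * s) < D σ}.indicator k s) :=
    (hk.comp measurable_snd).indicator hS
  rw [lintegral_lintegral_swap hm.aemeasurable]
  refine setLIntegral_mono' measurableSet_Ioo fun s hs => ?_
  have hs0 : 0 < s := hr.trans_lt hs.1
  refine le_trans ?_ (mul_le_mul_right (hF s hs0) _)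
  have hms : MeasurableSet {σ : ℝ | ENNReal.ofReal (V * s) < D σ} :=
    measurableSet_lt measurable_const hD
  calc ∫⁻ σ in Ioi (0 : ℝ), {s : ℝ | ENNReal.ofReal (V * s) < D σ}.indicator k s
      = ∫⁻ σ in Ioi (0 : ℝ), {σ : ℝ | ENNReal.ofReal (V * s) < D σ}.indicator
          (fun _ => k s) σ := rfl
    _ = k s * volume {σ : ℝ | 0 < σ ∧ ENNReal.ofReal (V * s) < D σ} := by
        rw [lintegral_indicator_const hms, Measure.restrict_apply hms, inter_comm]
        rfl
    _ ≤ _ := le_rfl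

lemma setLIntegral_rpow_small_le (hV : 0 < V) (hD : Measurable D)
    (hF : ∀ s, 0 < s → volume {σ : ℝ | 0 < σ ∧ ENNReal.ofReal (V * s) < D σ} ≤ F s)
    {β τ : ℝ} (hβ : 0 < β) :
    ∫⁻ σ in Ioi (0 : ℝ) ∩ {σ | D σ ≤ ENNReal.ofReal (V * τ)}, D σ ^ β ≤
      ENNReal.ofReal (V ^ β * β) * ∫⁻ s in Ioo 0 τ, ENNReal.ofReal (s ^ (β - 1)) * F s := by
  have hms : MeasurableSet {σ | D σ ≤ ENNReal.ofReal (V * τ)} :=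
    measurableSet_le hD measurable_const
  refine (setLIntegral_mono' (measurableSet_Ioi.inter hms) fun σ hσ =>
    rpow_le_add_lintegral_indicator hV hβ le_rfl (by simp) hσ.2).trans ?_
  simp only [Real.zero_rpow hβ.ne', ENNReal.ofReal_zero, zero_add, ← mul_assoc,
    ← ENNReal.ofReal_mul (Real.rpow_nonneg hV.le β)]
  rw [lintegral_const_mul' _ _ ENNReal.ofReal_ne_top]
  refine mul_le_mul_right ((lintegral_mono_set inter_subset_left).trans ?_) _
  exact lintegral_lintegral_indicator_le hD hF (by fun_prop) le_rfl

lemma setLIntegral_rpow_large_le (hV : 0 < V) (hD : Measurable D)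
    (hDV : ∀ σ, D σ ≤ ENNReal.ofReal V)
    (hF : ∀ s, 0 < s → volume {σ : ℝ | 0 < σ ∧ ENNReal.ofReal (V * s) < D σ} ≤ F s)
    {β τ : ℝ} (hβ : 0 < β) (hτ : 0 < τ) :
    ∫⁻ σ in Ioi (0 : ℝ) ∩ {σ | ENNReal.ofReal (V * τ) < D σ}, D σ ^ β ≤
      ENNReal.ofReal (V ^ β) * (ENNReal.ofReal (τ ^ β) * F τ + ENNReal.ofReal β *
        ∫⁻ s in Ioo τ 1, ENNReal.ofReal (s ^ (β - 1)) * F s) := by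
  have hms : MeasurableSet {σ | ENNReal.ofReal (V * τ) < D σ} :=
    measurableSet_lt measurable_const hD
  refine (setLIntegral_mono' (measurableSet_Ioi.inter hms) fun σ hσ =>
    rpow_le_add_lintegral_indicator (R := 1) hV hβ hτ.le (le_of_lt hσ.2)
      (by simpa using hDV σ)).trans ?_
  rw [lintegral_const_mul' _ _ ENNReal.ofReal_ne_top, lintegral_add_left measurable_const,
    lintegral_const_mul' _ _ ENNReal.ofReal_ne_top, setLIntegral_const]
  refine mul_le_mul_right (add_le_add (mul_le_mul_right (hF τ hτ) _) (mul_le_mul_right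
    ((lintegral_mono_set inter_subset_left).trans ?_) _)) _
  exact lintegral_lintegral_indicator_le hD hF (by fun_prop) hτ.le

end Distribution

lemma rpow_average_rearr_le {α : Type*} [MeasurableSpace α] {μ : Measure α} [SFinite μ]
    {u : α → ℝ} {a : ℝ≥0∞} {T : α → ℝ≥0∞} (hT : Measurable T)
    (hu : ∀ x, ENNReal.ofReal |u x| ≤ a + T x) {M p t : ℝ} (hM : 0 < M) (hp : 1 ≤ p)
    (ht : 0 < t) :
    ((ENNReal.ofReal t)⁻¹ * ∫⁻ s in Ioo (0 : ℝ) t, rearr μ u (M * s) ^ p) ^ (1 / p) ≤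
      a + (ENNReal.ofReal t)⁻¹ ^ (1 / p) *
        ((ENNReal.ofReal M)⁻¹ ^ (1 / p) * (∫⁻ x, T x ^ p ∂μ) ^ (1 / p)) := by
  have hp0 : 0 < p := by linarith
  have hip : 0 ≤ 1 / p := by positivity
  have ht0 : ENNReal.ofReal t ≠ 0 := (ENNReal.ofReal_pos.2 ht).ne'
  have hTm : Measurable fun s : ℝ => decreasingRearr μ T (M * s) :=
    (antitone_decreasingRearr μ T).measurable.comp (measurable_const_mul M)
  have hmink := ENNReal.lintegral_Lp_add_le (μ := volume.restrict (Ioo 0 t))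
    (f := fun _ : ℝ => a) (g := fun s : ℝ => decreasingRearr μ T (M * s))
    aemeasurable_const hTm.aemeasurable hp
  have h1 : (∫⁻ s in Ioo (0 : ℝ) t, rearr μ u (M * s) ^ p) ^ (1 / p) ≤
      a * ENNReal.ofReal t ^ (1 / p) +
        ((ENNReal.ofReal M)⁻¹ * ∫⁻ x, T x ^ p ∂μ) ^ (1 / p) := by
    refine le_trans (ENNReal.rpow_le_rpow (lintegral_mono fun s => ENNReal.rpow_le_rpow
      (decreasingRearr_le_add hu (M * s)) hp0.le) hip) (hmink.trans (add_le_add ?_ ?_))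
    · rw [setLIntegral_const, Real.volume_Ioo, sub_zero, ENNReal.mul_rpow_of_nonneg _ _ hip,
        ← ENNReal.rpow_mul, mul_one_div_cancel hp0.ne', ENNReal.rpow_one]
    · exact ENNReal.rpow_le_rpow ((lintegral_mono_set Ioo_subset_Ioi_self).trans
        (lintegral_decreasingRearr_rpow_le hT hM hp0)) hip
  rw [ENNReal.mul_rpow_of_nonneg _ _ hip]
  refine (mul_le_mul_right h1 _).trans (le_of_eq ?_)
  rw [mul_add, mul_left_comm, ← ENNReal.mul_rpow_of_nonneg _ _ hip,
    ENNReal.inv_mul_cancel ht0 ENNReal.ofReal_ne_top, ENNReal.one_rpow, mul_one,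
    ENNReal.mul_rpow_of_nonneg _ _ hip]

lemma rearr_le_rpow_average {α : Type*} [MeasurableSpace α] (μ : Measure α) (u : α → ℝ)
    {M p t : ℝ} (hM : 0 ≤ M) (hp : 0 < p) (ht : 0 < t) :
    rearr μ u (M * t) ≤
      ((ENNReal.ofReal t)⁻¹ * ∫⁻ s in Ioo (0 : ℝ) t, rearr μ u (M * s) ^ p) ^ (1 / p) := by
  have ht0 : ENNReal.ofReal t ≠ 0 := (ENNReal.ofReal_pos.2 ht).ne'
  have h : rearr μ u (M * t) ^ p * ENNReal.ofReal t ≤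
      ∫⁻ s in Ioo (0 : ℝ) t, rearr μ u (M * s) ^ p := by
    calc rearr μ u (M * t) ^ p * ENNReal.ofReal t
        = ∫⁻ _ in Ioo (0 : ℝ) t, rearr μ u (M * t) ^ p := by
          rw [setLIntegral_const, Real.volume_Ioo, sub_zero]
      _ ≤ _ := setLIntegral_mono' measurableSet_Ioo fun s hs => ENNReal.rpow_le_rpow
          (antitone_decreasingRearr μ _ (mul_le_mul_of_nonneg_left hs.2.le hM)) hp.le
  calc rearr μ u (M * t)
      = ((ENNReal.ofReal t)⁻¹ * (rearr μ u (M * t) ^ p * ENNReal.ofReal t)) ^ (1 / p) := by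
        rw [mul_left_comm, ENNReal.inv_mul_cancel ht0 ENNReal.ofReal_ne_top, mul_one,
          ← ENNReal.rpow_mul, mul_one_div_cancel hp.ne', ENNReal.rpow_one]
    _ ≤ _ := ENNReal.rpow_le_rpow (mul_le_mul_right h _) (by positivity)

/-- A non-increasing function is controlled by `S2` at the endpoint of integration. -/
lemma ofReal_rpow_mul_le_S2 {n m : ℕ} {d : ℝ} (hm : 1 ≤ m) (hd0 : 0 < d) (hdn : d < n)
    {f : ℝ → ℝ≥0∞} (hf : Antitone f) {t : ℝ} (ht : 0 < t) :
    ENNReal.ofReal ((t ^ ((n : ℝ) / d)) ^ ((m : ℝ) / n)) * f (t ^ ((n : ℝ) / d)) ≤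
      ENNReal.ofReal ((m : ℝ) / (n - d)) * S2 n m d f t := by
  have hnd : 0 < (n : ℝ) - d := by linarith
  have hm0 : (0 : ℝ) < m := by exact_mod_cast hm
  have hn0 : (0 : ℝ) < n := by linarith
  set β := (m : ℝ) / (n - d) with hβ
  have hβ0 : 0 < β := by positivity
  set τ := t ^ ((n : ℝ) / d) with hτ
  have hτ0 : 0 < τ := by positivity
  have h : ENNReal.ofReal (τ ^ β / β) * f τ ≤
      ∫⁻ s in Ioo (0 : ℝ) τ, ENNReal.ofReal (s ^ (β - 1)) * f s := by
    calc ENNReal.ofReal (τ ^ β / β) * f τ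
        = ∫⁻ s in Ioo (0 : ℝ) τ, ENNReal.ofReal (s ^ (β - 1)) * f τ := by
          rw [lintegral_mul_const _ (by fun_prop),
            lintegral_Ioo_rpow le_rfl hτ0.le (Or.inr hβ0) hβ0.ne', Real.zero_rpow hβ0.ne', sub_zero]
      _ ≤ _ := setLIntegral_mono' measurableSet_Ioo fun s hs => mul_le_mul_right (hf hs.2.le) _
  have hexp : τ ^ ((m : ℝ) / n) = β * (t ^ (-β) * (τ ^ β / β)) := by
    have : β * (t ^ (-β) * (τ ^ β / β)) = t ^ (-β) * τ ^ β := by field_simp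
    rw [this, hτ, ← Real.rpow_mul ht.le, ← Real.rpow_mul ht.le, ← Real.rpow_add ht]
    congr 1
    rw [hβ]
    field_simp
    ring
  rw [hexp, ENNReal.ofReal_mul hβ0.le, ENNReal.ofReal_mul (by positivity), mul_assoc, mul_assoc]
  exact mul_le_mul_right (mul_le_mul_right h _) _

lemma measurable_uncurry_setPotential_level {n : ℕ} (γ : ℝ)
    {g : EuclideanSpace ℝ (Fin n) → ℝ≥0∞} (hg : Measurable g) :
    Measurable (Function.uncurry fun (x : EuclideanSpace ℝ (Fin n)) (σ : ℝ) =>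
      setPotential γ {y | ENNReal.ofReal σ < g y} x) := by
  have hS : MeasurableSet {q : (EuclideanSpace ℝ (Fin n) × ℝ) × EuclideanSpace ℝ (Fin n) |
      ENNReal.ofReal q.1.2 < g q.2} :=
    measurableSet_lt (by fun_prop) (hg.comp measurable_snd)
  have hk : Measurable fun q : (EuclideanSpace ℝ (Fin n) × ℝ) × EuclideanSpace ℝ (Fin n) =>
      ENNReal.ofReal (dist q.2 q.1.1 ^ (-γ)) := by fun_prop
  have := (hk.indicator hS).lintegral_prod_right' (ν := volume)
  convert this using 1
  funext q
  exact (lintegral_indicator (measurableSet_lt measurable_const hg) _).symm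

/-- Pointwise rearrangement estimate behind the reduction principle. -/
lemma exists_rpow_average_rearr_le (n m : ℕ) (hm : 1 ≤ m) (hmn : m < n) {d : ℝ} (hd0 : 0 < d)
    (hd : d < (n : ℝ) - m) {Ω : Set (EuclideanSpace ℝ (Fin n))} (hΩ : MeasurableSet Ω)
    (hΩvol : volume Ω < ⊤) {V : ℝ} (hV : 0 < V) (hVΩ : volume Ω = ENNReal.ofReal V)
    (μ : Measure (EuclideanSpace ℝ (Fin n))) [IsFiniteMeasure μ] {A : ℝ} (hA : 0 ≤ A)
    (hμ : ∀ x r, 0 < r → μ (Metric.ball x r) ≤ ENNReal.ofReal (A * r ^ d)) {M : ℝ} (hM : 0 < M)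
    (K : ℝ) :
    ∃ C : ℝ≥0, ∀ (u w : EuclideanSpace ℝ (Fin n) → ℝ) (B : ℝ), Measurable w →
      (∀ y, |w y| ≤ B) → (∀ y, w y ≠ 0 → y ∈ Ω) →
      (∀ x, ENNReal.ofReal |u x| ≤ ENNReal.ofReal K *
        ∫⁻ y, ENNReal.ofReal (dist y x ^ (-((n : ℝ) - m))) * ENNReal.ofReal |w y|) →
      ∀ t ∈ Ioo (0 : ℝ) 1,
        ((ENNReal.ofReal t)⁻¹ * ∫⁻ s in Ioo (0 : ℝ) t, rearr μ u (M * s) ^ (((n : ℝ) - d) / m)) ^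
            ((m : ℝ) / ((n : ℝ) - d)) ≤
          C * (S1 n m d (fun t => rearr (volume.restrict Ω) w (V * t)) t +
            S2 n m d (fun t => rearr (volume.restrict Ω) w (V * t)) t) := by
  have hm0 : (0 : ℝ) < m := by exact_mod_cast hm
  have hn1 : 1 ≤ n := by omega
  have hn0 : (0 : ℝ) < n := by exact_mod_cast hn1
  have hmnR : (m : ℝ) < n := by exact_mod_cast hmn
  have hnd : 0 < (n : ℝ) - d := by linarith
  set γ : ℝ := (n : ℝ) - m with hγ
  have hγ0 : 0 < γ := by rw [hγ]; linarith
  have hγn : γ < n := by rw [hγ]; linarith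
  have hnγ : (n : ℝ) - γ = m := by rw [hγ]; ring
  obtain ⟨Ca, hCa, hpot⟩ := exists_setPotential_le_volume_rpow n hn1 hγ0 hγn
  obtain ⟨Cb, hCb, hpotμ⟩ := exists_lintegral_setPotential_rpow_le n hn1 hγn hd0 hd hA μ hμ
  rw [hnγ] at hpot hpotμ
  set p : ℝ := ((n : ℝ) - d) / m with hp
  have hp1 : 1 < p := by rw [hp, one_lt_div hm0]; linarith
  have hp0 : 0 < p := by linarith
  have hip : 1 / p = (m : ℝ) / (n - d) := by rw [hp, one_div_div]
  set β : ℝ := (m : ℝ) / (n - d) with hβ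
  have hβ0 : 0 < β := by positivity
  set θ : ℝ := (m : ℝ) / n with hθ
  have hθ0 : 0 < θ := by positivity
  set c₁ : ℝ≥0∞ := ENNReal.ofReal K * (ENNReal.ofReal Ca * ENNReal.ofReal (V ^ θ)) with hc₁
  set c₂ : ℝ≥0∞ := (ENNReal.ofReal M)⁻¹ ^ β *
    (ENNReal.ofReal K * (ENNReal.ofReal Cb ^ β * ENNReal.ofReal (V ^ β * β))) with hc₂
  have hMt : (ENNReal.ofReal M)⁻¹ ≠ ⊤ := ENNReal.inv_ne_top.2 (ENNReal.ofReal_pos.2 hM).ne'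
  have hc₁t : c₁ ≠ ⊤ := by
    rw [hc₁]; exact ENNReal.mul_ne_top (by simp) (ENNReal.mul_ne_top (by simp) (by simp))
  have hc₂t : c₂ ≠ ⊤ := by
    rw [hc₂]
    exact ENNReal.mul_ne_top (ENNReal.rpow_ne_top_of_nonneg hβ0.le hMt) (ENNReal.mul_ne_top
      (by simp) (ENNReal.mul_ne_top (ENNReal.rpow_ne_top_of_nonneg hβ0.le (by simp)) (by simp)))
  set Cf : ℝ≥0∞ := c₁ * (ENNReal.ofReal β + ENNReal.ofReal θ) + c₂ with hCf
  have hCft : Cf ≠ ⊤ := by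
    rw [hCf]
    exact ENNReal.add_ne_top.2 ⟨ENNReal.mul_ne_top hc₁t (by simp), hc₂t⟩
  refine ⟨Cf.toNNReal, fun u w B hw hwB hwΩ hu t ht => ?_⟩
  rw [ENNReal.coe_toNNReal hCft]
  set g : EuclideanSpace ℝ (Fin n) → ℝ≥0∞ := fun y => ENNReal.ofReal |w y| with hg
  have hgm : Measurable g := by fun_prop
  set f : ℝ → ℝ≥0∞ := fun t => rearr (volume.restrict Ω) w (V * t) with hf
  have hfanti : Antitone f := fun a b hab =>
    antitone_decreasingRearr _ _ (mul_le_mul_of_nonneg_left hab hV.le)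
  set G : ℝ → Set (EuclideanSpace ℝ (Fin n)) := fun σ => {y | ENNReal.ofReal σ < g y} with hG
  have hGm : ∀ σ, MeasurableSet (G σ) := fun σ => measurableSet_lt measurable_const hgm
  have hGΩ : ∀ σ, G σ ⊆ Ω := fun σ y hy => hwΩ y fun h0 => by
    have hy' : ENNReal.ofReal σ < g y := hy
    simp [hg, h0] at hy'
  have hGt : ∀ σ, volume (G σ) < ⊤ := fun σ => (measure_mono (hGΩ σ)).trans_lt hΩvol
  set D : ℝ → ℝ≥0∞ := fun σ => volume (G σ) with hD
  have hDanti : Antitone D := fun a b hab => measure_mono fun y hy =>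
    (ENNReal.ofReal_le_ofReal hab).trans_lt hy
  have hDm : Measurable D := hDanti.measurable
  have hDV : ∀ σ, D σ ≤ ENNReal.ofReal V := fun σ => (measure_mono (hGΩ σ)).trans hVΩ.le
  have hF : ∀ s, 0 < s → volume {σ : ℝ | 0 < σ ∧ ENNReal.ofReal (V * s) < D σ} ≤ f s := by
    intro s _
    refine (measure_mono ?_).trans (volume_Ioi_inter_ofReal_le (f s))
    intro σ hσ
    refine ⟨hσ.1, le_decreasingRearr ?_⟩
    have h2 : ENNReal.ofReal (V * s) < volume (G σ) := hσ.2
    rw [← Measure.restrict_eq_self volume (hGΩ σ)] at h2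
    exact h2
  set H : EuclideanSpace ℝ (Fin n) → ℝ → ℝ≥0∞ := fun x σ => setPotential γ (G σ) x with hH
  have hHm : Measurable (Function.uncurry H) := measurable_uncurry_setPotential_level γ hgm
  have hlayer : ∀ x, ∫⁻ y, ENNReal.ofReal (dist y x ^ (-γ)) * g y =
      ∫⁻ σ in Ioi (0 : ℝ), H x σ := fun x =>
    lintegral_mul_eq_lintegral_setLIntegral volume (by fun_prop) hgm
  set τ : ℝ := t ^ ((n : ℝ) / d) with hτ
  have hτ0 : 0 < τ := Real.rpow_pos_of_pos ht.1 _
  set A₁ : Set ℝ := Ioi (0 : ℝ) ∩ {σ | ENNReal.ofReal (V * τ) < D σ} with hA₁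
  set A₂ : Set ℝ := Ioi (0 : ℝ) ∩ {σ | D σ ≤ ENNReal.ofReal (V * τ)} with hA₂
  have hA₁m : MeasurableSet A₁ := measurableSet_Ioi.inter (measurableSet_lt measurable_const hDm)
  have hA₂m : MeasurableSet A₂ := measurableSet_Ioi.inter (measurableSet_le hDm measurable_const)
  set T : EuclideanSpace ℝ (Fin n) → ℝ≥0∞ := fun x => ∫⁻ σ in A₂, H x σ with hT
  have hTm : Measurable T := hHm.lintegral_prod_right'
  have hTbdd : ∃ b : ℝ≥0∞, b ≠ ⊤ ∧ ∀ x, T x ≤ b := by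
    refine ⟨ENNReal.ofReal B * (ENNReal.ofReal Ca * volume Ω ^ (m / n : ℝ)),
      ENNReal.mul_ne_top (by simp) (ENNReal.mul_ne_top (by simp)
        (ENNReal.rpow_ne_top_of_nonneg hθ0.le hΩvol.ne)), fun x => ?_⟩
    calc T x ≤ ∫⁻ σ in Ioi (0 : ℝ), H x σ := lintegral_mono_set inter_subset_left
      _ = ∫⁻ y, ENNReal.ofReal (dist y x ^ (-γ)) * g y := (hlayer x).symm
      _ ≤ ∫⁻ y, ENNReal.ofReal B * Ω.indicator (fun y => ENNReal.ofReal (dist y x ^ (-γ))) y := by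
          refine lintegral_mono fun y => ?_
          by_cases hy : y ∈ Ω
          · rw [indicator_of_mem hy, mul_comm]
            exact mul_le_mul_left (ENNReal.ofReal_le_ofReal (hwB y)) _
          · have : w y = 0 := by
              by_contra h0
              exact hy (hwΩ y h0)
            simp [hg, this]
      _ = ENNReal.ofReal B * setPotential γ Ω x := by
          rw [lintegral_const_mul' _ _ ENNReal.ofReal_ne_top, lintegral_indicator hΩ]
          rfl
      _ ≤ _ := mul_le_mul_right (hpot Ω x hΩvol) _
  have hTfin : ∫⁻ x, T x ^ p ∂μ ≠ ⊤ := by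
    obtain ⟨b, hb, hTb⟩ := hTbdd
    refine ne_top_of_le_ne_top (b := b ^ p * μ univ) (ENNReal.mul_ne_top
      (ENNReal.rpow_ne_top_of_nonneg hp0.le hb) (measure_ne_top _ _)) ?_
    rw [← lintegral_const]
    exact lintegral_mono fun x => ENNReal.rpow_le_rpow (hTb x) hp0.le
  have hnear : ∀ x, ∫⁻ σ in A₁, H x σ ≤ ENNReal.ofReal Ca * ∫⁻ σ in A₁, D σ ^ θ := fun x => by
    rw [← lintegral_const_mul' _ _ ENNReal.ofReal_ne_top]
    exact lintegral_mono fun σ => hpot (G σ) x (hGt σ)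
  set a : ℝ≥0∞ := ENNReal.ofReal K * (ENNReal.ofReal Ca * ∫⁻ σ in A₁, D σ ^ θ) with ha
  have huaT : ∀ x, ENNReal.ofReal |u x| ≤ a + ENNReal.ofReal K * T x := fun x => by
    refine (hu x).trans ?_
    rw [hlayer x, ha, ← mul_add]
    refine mul_le_mul_right ?_ _
    have hun : Ioi (0 : ℝ) ⊆ A₁ ∪ A₂ := fun σ hσ => by
      rcases lt_or_ge (ENNReal.ofReal (V * τ)) (D σ) with h | h
      · exact Or.inl ⟨hσ, h⟩
      · exact Or.inr ⟨hσ, h⟩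
    exact (lintegral_mono_set hun).trans ((lintegral_union_le _ _ _).trans
      (add_le_add_left (hnear x) _))
  have hmain := rpow_average_rearr_le (μ := μ) (hTm.const_mul (ENNReal.ofReal K)) huaT hM hp1.le ht.1
  rw [hip] at hmain
  refine hmain.trans ?_
  have haS : a ≤ c₁ * (ENNReal.ofReal β * S2 n m d f t + ENNReal.ofReal θ * S1 n m d f t) := by
    rw [ha, hc₁, mul_assoc, mul_assoc]
    refine mul_le_mul_right (mul_le_mul_right ?_ _) _
    refine (setLIntegral_rpow_large_le hV hDm hDV hF hθ0 hτ0).trans ?_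
    refine mul_le_mul_right (add_le_add_left ?_ _) _
    exact ofReal_rpow_mul_le_S2 hm hd0 (by linarith) hfanti ht.1
  have hTS : (∫⁻ x, T x ^ p ∂μ) ^ β ≤ ENNReal.ofReal Cb ^ β *
      (ENNReal.ofReal (V ^ β * β) * ∫⁻ s in Ioo 0 τ, ENNReal.ofReal (s ^ (β - 1)) * f s) := by
    have h1 := lintegral_lintegral_rpow_le (μ := μ) (ν := volume.restrict A₂) hHm hp1 hTfin
    rw [hip] at h1
    refine h1.trans ?_
    calc ∫⁻ σ in A₂, (∫⁻ x, H x σ ^ p ∂μ) ^ β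
        ≤ ∫⁻ σ in A₂, ENNReal.ofReal Cb ^ β * D σ ^ β := by
          refine lintegral_mono fun σ => ?_
          rw [← ENNReal.mul_rpow_of_nonneg _ _ hβ0.le]
          exact ENNReal.rpow_le_rpow (hpotμ (G σ) (hGm σ) (hGt σ)) hβ0.le
      _ = ENNReal.ofReal Cb ^ β * ∫⁻ σ in A₂, D σ ^ β :=
          lintegral_const_mul' _ _ (ENNReal.rpow_ne_top_of_nonneg hβ0.le (by simp))
      _ ≤ _ := mul_le_mul_right (setLIntegral_rpow_small_le hV hDm hF hβ0) _
  have hKT : (∫⁻ x, (ENNReal.ofReal K * T x) ^ p ∂μ) ^ β =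
      ENNReal.ofReal K * (∫⁻ x, T x ^ p ∂μ) ^ β := by
    simp only [ENNReal.mul_rpow_of_nonneg _ _ hp0.le]
    rw [lintegral_const_mul' _ _ (ENNReal.rpow_ne_top_of_nonneg hp0.le (by simp)),
      ENNReal.mul_rpow_of_nonneg _ _ hβ0.le, ← ENNReal.rpow_mul, ← hip,
      mul_one_div_cancel hp0.ne', ENNReal.rpow_one]
  have htβ : (ENNReal.ofReal t)⁻¹ ^ β = ENNReal.ofReal (t ^ (-β)) := by
    rw [ENNReal.inv_rpow, ← ENNReal.rpow_neg, ENNReal.ofReal_rpow_of_pos ht.1]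
  have hfar : (ENNReal.ofReal t)⁻¹ ^ β * ((ENNReal.ofReal M)⁻¹ ^ β *
      (∫⁻ x, (ENNReal.ofReal K * T x) ^ p ∂μ) ^ β) ≤ c₂ * S2 n m d f t := by
    rw [hKT]
    refine (mul_le_mul_right (mul_le_mul_right (mul_le_mul_right hTS (ENNReal.ofReal K))
      ((ENNReal.ofReal M)⁻¹ ^ β)) ((ENNReal.ofReal t)⁻¹ ^ β)).trans (le_of_eq ?_)
    rw [htβ, hc₂, S2]
    ring
  refine (add_le_add haS hfar).trans ?_
  set x := S1 n m d f t
  set y := S2 n m d f t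
  calc c₁ * (ENNReal.ofReal β * y + ENNReal.ofReal θ * x) + c₂ * y
      ≤ c₁ * (ENNReal.ofReal β * (x + y) + ENNReal.ofReal θ * (x + y)) + c₂ * (x + y) := by
        gcongr <;> simp
    _ = Cf * (x + y) := by rw [hCf]; ring

/-- **Reduction principle for slowly decaying measures (`0 < d < n-m`), first version:**
the pair of Hardy-type inequalities for `S₁` and `S₂` implies the Sobolev trace inequality
with target norm `Y^{⟨(n-d)/m⟩}`, and in particular with target norm `Y`. -/
theorem reduction_principle_slow_first (n m : ℕ) (hn : 2 ≤ n) (hm : 1 ≤ m) (hmn : m < n)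
    (d : ℝ) (hd0 : 0 < d) (hd : d < (n : ℝ) - m)
    (Ω : Set (EuclideanSpace ℝ (Fin n))) (hΩ : IsOpen Ω) (hΩvol : volume Ω < ⊤)
    (NX NY : (ℝ → ℝ≥0∞) → ℝ≥0∞) (hX : IsRINorm NX) (hY : IsRINorm NY)
    (μ : Measure (EuclideanSpace ℝ (Fin n))) (hfin : IsFiniteMeasure μ) (hsupp : μ Ωᶜ = 0)
    (hFrostman : ∃ A : ℝ, ∀ (x : EuclideanSpace ℝ (Fin n)) (r : ℝ), 0 < r →
        μ (Metric.ball x r ∩ Ω) ≤ ENNReal.ofReal (A * r ^ d))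
    (C₁ : ℝ)
    (hHardy1 : ∀ f : ℝ → ℝ≥0∞, Measurable f → AntitoneOn f (Set.Ioo 0 1) →
        NY (S1 n m d f) ≤ ENNReal.ofReal C₁ * NX f)
    (hHardy2 : ∀ f : ℝ → ℝ≥0∞, Measurable f → AntitoneOn f (Set.Ioo 0 1) →
        NY (S2 n m d f) ≤ ENNReal.ofReal C₁ * NX f) :
    ∃ C₂ : ℝ, ∀ u : EuclideanSpace ℝ (Fin n) → ℝ,
      ContDiff ℝ (⊤ : ℕ∞) u → HasCompactSupport u → tsupport u ⊆ Ω →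
      (NY (fun t => ((ENNReal.ofReal t)⁻¹ *
            ∫⁻ s in Set.Ioo (0 : ℝ) t,
              (rearr μ u ((μ Ω).toReal * s)) ^ (((n : ℝ) - d) / m)) ^
          ((m : ℝ) / ((n : ℝ) - d))) ≤
        ENNReal.ofReal C₂ *
          NX (fun t => rearr (volume.restrict Ω) (fun x => ‖iteratedFDeriv ℝ m u x‖)
            ((volume Ω).toReal * t))) ∧
      NY (fun t => rearr μ u ((μ Ω).toReal * t)) ≤
        ENNReal.ofReal C₂ *
          NX (fun t => rearr (volume.restrict Ω) (fun x => ‖iteratedFDeriv ℝ m u x‖)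
            ((volume Ω).toReal * t)) := by
  obtain ⟨A₀, hA₀⟩ := hFrostman
  obtain ⟨K, -, hK⟩ := exists_enorm_le_riesz n m hm hmn
  have hm0 : (0 : ℝ) < m := by exact_mod_cast hm
  have hnd : 0 < (n : ℝ) - d := by linarith
  have hβ0 : 0 < (m : ℝ) / ((n : ℝ) - d) := by positivity
  have hp0 : 0 < ((n : ℝ) - d) / m := by positivity
  have hμ : ∀ x r, 0 < r → μ (Metric.ball x r) ≤ ENNReal.ofReal (|A₀| * r ^ d) := by
    intro x r hr
    calc μ (Metric.ball x r) ≤ μ (Metric.ball x r ∩ Ω) + μ Ωᶜ := by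
          refine (measure_mono fun y hy => ?_).trans (measure_union_le _ _)
          by_cases hyΩ : y ∈ Ω
          · exact Or.inl ⟨hy, hyΩ⟩
          · exact Or.inr hyΩ
      _ ≤ ENNReal.ofReal (A₀ * r ^ d) := by rw [hsupp, add_zero]; exact hA₀ x r hr
      _ ≤ _ := ENNReal.ofReal_le_ofReal
          (mul_le_mul_of_nonneg_right (le_abs_self _) (by positivity))
  set M := (μ Ω).toReal with hM
  set V := (volume Ω).toReal with hV
  have hpt : ∃ C : ℝ≥0, ∀ u : EuclideanSpace ℝ (Fin n) → ℝ,
      ContDiff ℝ (⊤ : ℕ∞) u → HasCompactSupport u → tsupport u ⊆ Ω → ∀ t ∈ Ioo (0 : ℝ) 1,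
        ((ENNReal.ofReal t)⁻¹ * ∫⁻ s in Ioo (0 : ℝ) t, rearr μ u (M * s) ^ (((n : ℝ) - d) / m)) ^
            ((m : ℝ) / ((n : ℝ) - d)) ≤
          C * (S1 n m d (fun t => rearr (volume.restrict Ω)
              (fun x => ‖iteratedFDeriv ℝ m u x‖) (V * t)) t +
            S2 n m d (fun t => rearr (volume.restrict Ω)
              (fun x => ‖iteratedFDeriv ℝ m u x‖) (V * t)) t) := by
    rcases eq_or_ne (μ Ω) 0 with h0 | h0
    · refine ⟨0, fun u _ _ _ t _ => ?_⟩
      have hμ0 : μ = 0 := by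
        rw [← Measure.measure_univ_eq_zero, ← union_compl_self Ω]
        exact le_antisymm ((measure_union_le _ _).trans (by rw [h0, hsupp, add_zero])) bot_le
      have hr : ∀ s, rearr μ u s = 0 := fun s =>
        le_antisymm (sInf_le (by simp [hμ0])) bot_le
      simp [hr, ENNReal.zero_rpow_of_pos hp0, ENNReal.zero_rpow_of_pos hβ0]
    · have hMpos : 0 < M := ENNReal.toReal_pos h0 (measure_ne_top _ _)
      have hΩne : Ω.Nonempty := nonempty_of_measure_ne_zero h0
      have hVpos : 0 < V := ENNReal.toReal_pos (hΩ.measure_pos volume hΩne).ne' hΩvol.ne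
      obtain ⟨C, hC⟩ := exists_rpow_average_rearr_le n m hm hmn hd0 hd hΩ.measurableSet hΩvol hVpos
        (ENNReal.ofReal_toReal hΩvol.ne).symm μ (abs_nonneg A₀) hμ hMpos K
      refine ⟨C, fun u hu hcs hsub => ?_⟩
      have hcont : Continuous (iteratedFDeriv ℝ m u) :=
        hu.continuous_iteratedFDeriv (by exact_mod_cast le_top)
      obtain ⟨B, hB⟩ := hcont.bounded_above_of_compact_support (hcs.iteratedFDeriv m)
      refine hC u (fun x => ‖iteratedFDeriv ℝ m u x‖) B hcont.norm.measurable
        (fun y => by rw [abs_norm]; exact hB y) (fun y hy => hsub ?_) (fun x => ?_)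
      · exact support_iteratedFDeriv_subset m (norm_ne_zero_iff.1 hy)
      · simp only [abs_norm]
        exact hK u hu hcs x
  obtain ⟨C, hC⟩ := hpt
  refine ⟨C * (C₁ ⊔ 0 + C₁ ⊔ 0), fun u hu hcs hsub => ?_⟩
  set f : ℝ → ℝ≥0∞ := fun t => rearr (volume.restrict Ω)
    (fun x => ‖iteratedFDeriv ℝ m u x‖) (V * t) with hf
  have hfanti : Antitone f := fun a b hab =>
    antitone_decreasingRearr _ _ (mul_le_mul_of_nonneg_left hab ENNReal.toReal_nonneg)
  have hae : ∀ {P : ℝ → Prop}, (∀ t ∈ Ioo (0 : ℝ) 1, P t) → ∀ᵐ t ∂vol01, P t := fun h =>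
    ae_restrict_of_forall_mem measurableSet_Ioo h
  have hsup : ENNReal.ofReal C₁ = ENNReal.ofReal (C₁ ⊔ 0) := by
    rcases le_total C₁ 0 with h | h
    · rw [ENNReal.ofReal_of_nonpos h, sup_eq_right.2 h, ENNReal.ofReal_zero]
    · rw [sup_eq_left.2 h]
  have hmain : NY (fun t => ((ENNReal.ofReal t)⁻¹ * ∫⁻ s in Ioo (0 : ℝ) t,
      rearr μ u (M * s) ^ (((n : ℝ) - d) / m)) ^ ((m : ℝ) / ((n : ℝ) - d))) ≤
      ENNReal.ofReal (C * (C₁ ⊔ 0 + C₁ ⊔ 0)) * NX f := by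
    calc _ ≤ NY (fun t => (C : ℝ≥0∞) * (S1 n m d f t + S2 n m d f t)) :=
          hY.mono _ _ (hae (hC u hu hcs hsub))
      _ = C * NY (fun t => S1 n m d f t + S2 n m d f t) := hY.smul C _
      _ ≤ C * (NY (S1 n m d f) + NY (S2 n m d f)) := mul_le_mul_right (hY.add_le _ _) _
      _ ≤ C * (ENNReal.ofReal C₁ * NX f + ENNReal.ofReal C₁ * NX f) :=
          mul_le_mul_right (add_le_add (hHardy1 f hfanti.measurable (hfanti.antitoneOn _))
            (hHardy2 f hfanti.measurable (hfanti.antitoneOn _))) _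
      _ = _ := by
          rw [hsup, ENNReal.ofReal_mul C.coe_nonneg, ENNReal.ofReal_add le_sup_right le_sup_right,
            ENNReal.ofReal_coe_nnreal]
          ring
  refine ⟨hmain, le_trans (hY.mono _ _ (hae fun t ht => ?_)) hmain⟩
  have h := rearr_le_rpow_average μ u (M := M) ENNReal.toReal_nonneg hp0 ht.1
  rwa [one_div_div] at h
end
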